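/- arXiv:2308.08768 — 2 statements merged into one kernel-verified Lean document; each statement's English description precedes it below -/
import Mathlib

section
/- Let G be a finite simple graph. If G is both (P3∪P2)-free and W4-free, then χ(G) ≤ 2·ω(G). -/
open SimpleGraph

/-- `P3 ∪ P2`: disjoint union of a path on 3 vertices (0-1-2) and an edge (3-4). -/
def P3P2 : SimpleGraph (Fin 5) :=
  SimpleGraph.fromEdgeSet {s(0,1), s(1,2), s(3,4)}

/-- `W4`: wheel on 5 vertices; 4-cycle 0-1-2-3-0 plus hub 4 adjacent to all. -/
def W4 : SimpleGraph (Fin 5) :=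
  SimpleGraph.fromEdgeSet {s(0,1), s(1,2), s(2,3), s(3,0), s(4,0), s(4,1), s(4,2), s(4,3)}

def NoP {V : Type*} (G : SimpleGraph V) : Prop :=
  ∀ a b c d e, G.Adj a b → G.Adj b c → G.Adj d e → a ≠ c → ¬ G.Adj a c →
    ¬ G.Adj a d → ¬ G.Adj a e → ¬ G.Adj b d → ¬ G.Adj b e → ¬ G.Adj c d → ¬ G.Adj c e → False

def NoW {V : Type*} (G : SimpleGraph V) : Prop :=
  ∀ a b c d h, G.Adj a b → G.Adj b c → G.Adj c d → G.Adj d a → a ≠ c → b ≠ d →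
    ¬ G.Adj a c → ¬ G.Adj b d → G.Adj h a → G.Adj h b → G.Adj h c → G.Adj h d → False

/-- `s` is properly coloured by colours `< n`. -/
def Col {V : Type*} (G : SimpleGraph V) (s : Finset V) (n : ℕ) : Prop :=
  ∃ f : V → ℕ, (∀ v ∈ s, f v < n) ∧ ∀ u ∈ s, ∀ v ∈ s, G.Adj u v → f u ≠ f v

/-- cliques inside `s` have at most `n` vertices. -/
def CB {V : Type*} (G : SimpleGraph V) (s : Finset V) (n : ℕ) : Prop :=
  ∀ Q : Finset V, Q ⊆ s → G.IsClique (Q : Set V) → Q.card ≤ n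

def NoC4 {V : Type*} (G : SimpleGraph V) (s : Finset V) : Prop :=
  ∀ a ∈ s, ∀ b ∈ s, ∀ c ∈ s, ∀ d ∈ s, G.Adj a b → G.Adj b c → G.Adj c d → G.Adj d a →
    a ≠ c → b ≠ d → ¬ G.Adj a c → ¬ G.Adj b d → False

def IsC5 {V : Type*} (G : SimpleGraph V) (a b c d e : V) : Prop :=
  G.Adj a b ∧ G.Adj b c ∧ G.Adj c d ∧ G.Adj d e ∧ G.Adj e a ∧
    ¬ G.Adj a c ∧ ¬ G.Adj b d ∧ ¬ G.Adj c e ∧ ¬ G.Adj d a ∧ ¬ G.Adj e b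

def IsC6 {V : Type*} (G : SimpleGraph V) (a b c d e f : V) : Prop :=
  G.Adj a b ∧ G.Adj b c ∧ G.Adj c d ∧ G.Adj d e ∧ G.Adj e f ∧ G.Adj f a ∧
    ¬ G.Adj a c ∧ ¬ G.Adj b d ∧ ¬ G.Adj c e ∧ ¬ G.Adj d f ∧ ¬ G.Adj e a ∧ ¬ G.Adj f b ∧
    ¬ G.Adj a d ∧ ¬ G.Adj b e ∧ ¬ G.Adj c f

def NoC5 {V : Type*} (G : SimpleGraph V) (s : Finset V) : Prop :=
  ∀ a ∈ s, ∀ b ∈ s, ∀ c ∈ s, ∀ d ∈ s, ∀ e ∈ s, ¬ IsC5 G a b c d e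

def NoC6 {V : Type*} (G : SimpleGraph V) (s : Finset V) : Prop :=
  ∀ a ∈ s, ∀ b ∈ s, ∀ c ∈ s, ∀ d ∈ s, ∀ e ∈ s, ∀ f ∈ s, ¬ IsC6 G a b c d e f

section basics
variable {V : Type*} {G : SimpleGraph V}

theorem Col.mono {s t : Finset V} {n m : ℕ} (h : Col G t n) (hs : s ⊆ t) (hn : n ≤ m) :
    Col G s m := by
  obtain ⟨f, h1, h2⟩ := h
  exact ⟨f, fun v hv => (h1 v (hs hv)).trans_le hn, fun u hu v hv => h2 u (hs hu) v (hs hv)⟩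

theorem CB.mono {s t : Finset V} {n m : ℕ} (h : CB G t n) (hs : s ⊆ t) (hn : n ≤ m) :
    CB G s m := fun Q hQ hc => (h Q (hQ.trans hs) hc).trans hn

open Classical in
theorem Col.union {s t : Finset V} {n m : ℕ} (h : Col G s n) (h' : Col G t m) :
    Col G (s ∪ t) (n + m) := by
  obtain ⟨f, h1, h2⟩ := h
  obtain ⟨g, h3, h4⟩ := h'
  refine ⟨fun v => if v ∈ s then f v else n + g v, ?_, ?_⟩
  · intro v hv
    by_cases hs : v ∈ s
    · have := h1 v hs
      simp only [hs, if_true]; omega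
    · have := h3 v (by simpa [hs] using hv)
      simp only [hs, if_false]; omega
  · intro u hu v hv huv
    by_cases hs : u ∈ s <;> by_cases ht : v ∈ s <;> simp only [hs, ht, if_true, if_false]
    · exact h2 u hs v ht huv
    · have := h1 u hs; omega
    · have := h1 v ht; omega
    · have := h4 u (by simpa [hs] using hu) v (by simpa [ht] using hv) huv
      omega

open Classical in
/-- degeneracy implies colourability -/
theorem col_of_degen {d : ℕ} (s : Finset V)
    (h : ∀ t ⊆ s, t.Nonempty → ∃ v ∈ t, (t.filter (G.Adj v)).card < d) : Col G s d := by
  induction hn : s.card generalizing s with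
  | zero =>
    rw [Finset.card_eq_zero] at hn
    subst hn
    exact ⟨fun _ => 0, by simp, by simp⟩
  | succ n ih =>
    obtain ⟨v, hv, hd⟩ := h s subset_rfl (Finset.card_pos.1 (by omega))
    obtain ⟨f, h1, h2⟩ := ih (s.erase v) (fun t ht => h t (ht.trans (Finset.erase_subset _ _)))
      (by rw [Finset.card_erase_of_mem hv]; omega)
    have hex : ∃ c ∈ Finset.range d, c ∉ (s.filter (G.Adj v)).image f := by
      by_contra hcon
      push Not at hcon
      have h3 : Finset.range d ⊆ (s.filter (G.Adj v)).image f := hcon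
      have := Finset.card_le_card h3
      have h4 : ((s.filter (G.Adj v)).image f).card ≤ _ := Finset.card_image_le
      simp at this
      omega
    obtain ⟨c, hc, hc'⟩ := hex
    have hc'' : ∀ w ∈ s, G.Adj v w → f w ≠ c := by
      intro w hw hvw he
      exact hc' (Finset.mem_image.2 ⟨w, by simp [hw, hvw], he⟩)
    refine ⟨fun w => if w = v then c else f w, ?_, ?_⟩
    · intro w hw
      by_cases hwv : w = v
      · simpa [hwv] using hc
      · simpa [hwv] using h1 w (by simp [hw, hwv])
    · intro u hu w hw huw
      by_cases hu' : u = v <;> by_cases hw' : w = v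
      · subst hu'; subst hw'; exact absurd huw (G.loopless.irrefl _)
      · subst hu'; simp only [hw', if_true, if_false]; exact (hc'' w hw huw).symm
      · subst hw'; simp only [hu', if_true, if_false]; exact hc'' u hu huw.symm
      · simp only [hu', hw', if_false]
        exact h2 u (by simp [hu, hu']) w (by simp [hw, hw']) huw

open Classical in
theorem clique_of_nbrs {t : Finset V} {v : V} (hv : v ∈ t)
    (h : ∀ a ∈ t, ∀ b ∈ t, G.Adj v a → G.Adj v b → a ≠ b → G.Adj a b) {n : ℕ}
    (hc : CB G t n) : (t.filter (G.Adj v)).card < n := by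
  have h1 := hc (insert v (t.filter (G.Adj v))) (by
      intro x hx; simp at hx; rcases hx with rfl | hx; exacts [hv, hx.1]) (by
      rw [Finset.coe_insert, SimpleGraph.isClique_insert]
      refine ⟨?_, ?_⟩
      · intro a ha b hb hab
        simp at ha hb
        exact h a ha.1 b hb.1 ha.2 hb.2 hab
      · intro b hb _
        simp at hb
        exact hb.2)
  rw [Finset.card_insert_of_notMem (by simp)] at h1
  omega

/-- P3-free sets -/
theorem col_of_p3free {s : Finset V}
    (h : ∀ v ∈ s, ∀ a ∈ s, ∀ b ∈ s, G.Adj v a → G.Adj v b → a ≠ b → G.Adj a b) {n : ℕ}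
    (hc : CB G s n) : Col G s n := by
  classical
  refine col_of_degen s ?_
  rintro t ht ⟨v, hv⟩
  exact ⟨v, hv, by
    convert clique_of_nbrs hv (fun a ha b hb => h v (ht hv) a (ht ha) b (ht hb)) (hc.mono ht le_rfl)⟩

open Classical in
theorem exists_simplicial (hP : NoP G) : ∀ (n : ℕ) (s : Finset V), s.card ≤ n →
    NoC4 G s → NoC5 G s → NoC6 G s → ∀ v ∈ s, (∃ w ∈ s, w ≠ v ∧ ¬ G.Adj v w) →
    ∃ w ∈ s, w ≠ v ∧ ¬ G.Adj v w ∧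
      ∀ a ∈ s, ∀ b ∈ s, G.Adj w a → G.Adj w b → a ≠ b → G.Adj a b := by
  intro n
  induction n with
  | zero =>
    intro s hs _ _ _ v hv
    rw [Nat.le_zero, Finset.card_eq_zero] at hs
    subst hs; simp at hv
  | succ n ih =>
    intro s hs h4 h5 h6 v hv ⟨w0, hw0, hw0v, hw0a⟩
    set N := s.filter (fun x => x ≠ v ∧ ¬ G.Adj v x) with hN
    have memN : ∀ x, x ∈ N ↔ x ∈ s ∧ x ≠ v ∧ ¬ G.Adj v x := by intro x; simp [hN]
    obtain ⟨C, hC, hmin⟩ := Finset.exists_min_image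
      (N.powerset.filter (fun C => C.Nonempty ∧ ∀ c ∈ C, ∀ x ∈ N, G.Adj c x → x ∈ C))
      Finset.card ⟨N, by
        simp only [Finset.mem_filter, Finset.mem_powerset, subset_rfl, true_and]
        exact ⟨⟨w0, (memN _).2 ⟨hw0, hw0v, hw0a⟩⟩, fun _ _ x hx _ => hx⟩⟩
    simp only [Finset.mem_filter, Finset.mem_powerset] at hC hmin
    obtain ⟨hCN, hCne, hCcl⟩ := hC
    have hCs : ∀ c ∈ C, c ∈ s ∧ c ≠ v ∧ ¬ G.Adj v c := fun c hc => (memN c).1 (hCN hc)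
    have hmin' : ∀ C' ⊆ C, C'.Nonempty → (∀ c ∈ C', ∀ x ∈ N, G.Adj c x → x ∈ C') → C' = C := by
      intro C' h1 h2 h3
      exact Finset.eq_of_subset_of_card_le h1 (hmin C' ⟨h1.trans hCN, h2, h3⟩)
    set S := s.filter (fun x => G.Adj v x ∧ ∃ c ∈ C, G.Adj x c) with hS
    have memS : ∀ x, x ∈ S ↔ x ∈ s ∧ G.Adj v x ∧ ∃ c ∈ C, G.Adj x c := by intro x; simp [hS]
    have hSc : ∀ x ∈ S, ∀ y ∈ S, x ≠ y → G.Adj x y := by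
      intro x hx y hy hxy
      by_contra hn
      obtain ⟨hxs, hvx, cx, hcx, hxcx⟩ := (memS x).1 hx
      obtain ⟨hys, hvy, cy, hcy, hycy⟩ := (memS y).1 hy
      have d1 : ∀ c ∈ C, G.Adj x c → ¬ G.Adj y c := by
        intro c hc hxc hyc
        exact h4 v hv x hxs c (hCs c hc).1 y hys hvx hxc hyc.symm hvy.symm (hCs c hc).2.1.symm hxy
          (hCs c hc).2.2 hn
      have d2 : ∀ a ∈ C, ∀ b ∈ C, G.Adj x a → G.Adj y b → ¬ G.Adj a b := by
        intro a ha b hb hxa hyb hab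
        exact h5 v hv x hxs a (hCs a ha).1 b (hCs b hb).1 y hys
          ⟨hvx, hxa, hab, hyb.symm, hvy.symm, (hCs a ha).2.2, fun h => d1 b hb h hyb,
            fun h => d1 a ha hxa h.symm, fun h => (hCs b hb).2.2 h.symm, fun h => hn h.symm⟩
      have d3 : ∀ a ∈ C, ∀ b ∈ C, ¬ G.Adj x a → ¬ G.Adj y a → ¬ G.Adj x b → ¬ G.Adj y b →
          ¬ G.Adj a b := by
        intro a ha b hb h1 h2 h3 h4 hab
        exact hP x v y a b hvx.symm hvy hab hxy hn h1 h3 (hCs a ha).2.2 (hCs b hb).2.2 h2 h4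
      set C' := C.filter (fun c => G.Adj x c ∨ (¬ G.Adj y c ∧ ∃ a ∈ C, G.Adj x a ∧ G.Adj a c))
        with hC'
      have memC' : ∀ c, c ∈ C' ↔ c ∈ C ∧ (G.Adj x c ∨ (¬ G.Adj y c ∧ ∃ a ∈ C, G.Adj x a ∧ G.Adj a c)) := by
        intro c; simp [hC']
      have hne : C' ≠ C := by
        intro he
        have : cy ∈ C' := he ▸ hcy
        rcases ((memC' _).1 this).2 with h | h
        · exact d1 cy hcy h hycy
        · exact h.1 hycy
      refine hne (hmin' C' (Finset.filter_subset _ _) ⟨cx, (memC' _).2 ⟨hcx, Or.inl hxcx⟩⟩ ?_)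
      intro p hp q hq hpq
      obtain ⟨hpC, hp'⟩ := (memC' _).1 hp
      have hqC : q ∈ C := hCcl p hpC q hq hpq
      by_contra hqn
      rw [memC'] at hqn
      push Not at hqn
      obtain ⟨hq1, hq2⟩ := hqn hqC
      by_cases hxp : G.Adj x p
      · by_cases hyq : G.Adj y q
        · exact d2 p hpC q hqC hxp hyq hpq
        · exact hq2 hyq p hpC hxp hpq
      · obtain ⟨hyp, a, haC, hxa, hap⟩ := hp'.resolve_left hxp
        by_cases hyq : G.Adj y q
        · exact h6 v hv x hxs a (hCs a haC).1 p (hCs p hpC).1 q (hCs q hqC).1 y hys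
            ⟨hvx, hxa, hap, hpq, hyq.symm, hvy.symm, (hCs a haC).2.2, hxp,
              fun h => d2 a haC q hqC hxa hyq h, fun h => hyp h.symm,
              fun h => (hCs q hqC).2.2 h.symm, fun h => hn h.symm, (hCs p hpC).2.2,
              fun h => hq1 h, fun h => d1 a haC hxa h.symm⟩
        · exact d3 p hpC q hqC hxp hyp hq1 hyq hpq
    -- recursion
    set t := C ∪ S with ht
    have hts : t ⊆ s := by
      intro x hx
      rcases Finset.mem_union.1 hx with h | h
      · exact (hCs x h).1
      · exact ((memS x).1 h).1
    have hvt : v ∉ t := by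
      intro hx
      rcases Finset.mem_union.1 hx with h | h
      · exact (hCs v h).2.1 rfl
      · exact G.loopless.irrefl _ ((memS v).1 h).2.1
    have htc : t.card ≤ n := by
      have : t.card < s.card := Finset.card_lt_card ⟨hts, fun h => hvt (h hv)⟩
      omega
    have hnb : ∀ c ∈ C, ∀ a ∈ s, G.Adj c a → a ∈ t := by
      intro c hc a ha hca
      have hav : a ≠ v := by
        rintro rfl; exact (hCs c hc).2.2 hca.symm
      by_cases hva : G.Adj v a
      · exact Finset.mem_union_right _ ((memS a).2 ⟨ha, hva, c, hc, hca.symm⟩)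
      · exact Finset.mem_union_left _ (hCcl c hc a ((memN a).2 ⟨ha, hav, hva⟩) hca)
    have fin : ∀ c ∈ C, (∀ a ∈ t, ∀ b ∈ t, G.Adj c a → G.Adj c b → a ≠ b → G.Adj a b) →
        ∃ w ∈ s, w ≠ v ∧ ¬ G.Adj v w ∧
      ∀ a ∈ s, ∀ b ∈ s, G.Adj w a → G.Adj w b → a ≠ b → G.Adj a b := by
      intro c hc h
      exact ⟨c, (hCs c hc).1, (hCs c hc).2.1, (hCs c hc).2.2, fun a ha b hb hca hcb =>
        h a (hnb c hc a ha hca) b (hnb c hc b hb hcb) hca hcb⟩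
    have ih' := ih t htc (fun a ha b hb c hc d hd => h4 a (hts ha) b (hts hb) c (hts hc) d (hts hd))
      (fun a ha b hb c hc d hd e he => h5 a (hts ha) b (hts hb) c (hts hc) d (hts hd) e (hts he))
      (fun a ha b hb c hc d hd e he f hf => h6 a (hts ha) b (hts hb) c (hts hc) d (hts hd) e (hts he) f (hts hf))
    by_cases hS0 : ∃ s0 ∈ S, ∃ w ∈ t, w ≠ s0 ∧ ¬ G.Adj s0 w
    · obtain ⟨s0, hs0, hw⟩ := hS0
      obtain ⟨w, hwt, hws, hwa, hsim⟩ := ih' s0 (Finset.mem_union_right _ hs0) hw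
      rcases Finset.mem_union.1 hwt with h | h
      · exact fin w h hsim
      · exact absurd (hSc s0 hs0 w h hws.symm) hwa
    · push Not at hS0
      by_cases hC0 : ∃ c0 ∈ C, ∃ w ∈ t, w ≠ c0 ∧ ¬ G.Adj c0 w
      · obtain ⟨c0, hc0, hw⟩ := hC0
        obtain ⟨w, hwt, hws, hwa, hsim⟩ := ih' c0 (Finset.mem_union_left _ hc0) hw
        rcases Finset.mem_union.1 hwt with h | h
        · exact fin w h hsim
        · exact absurd (hS0 w h c0 (Finset.mem_union_left _ hc0) hws.symm).symm hwa
      · push Not at hC0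
        obtain ⟨c, hc⟩ := hCne
        refine fin c hc ?_
        intro a ha b hb _ _ hab
        rcases Finset.mem_union.1 ha with h | h
        · exact hC0 a h b hb hab.symm
        · exact hS0 a h b hb hab.symm

theorem col_chordal (hP : NoP G) {s : Finset V} (h4 : NoC4 G s) (h5 : NoC5 G s) (h6 : NoC6 G s)
    {n : ℕ} (hc : CB G s n) : Col G s n := by
  classical
  refine col_of_degen s ?_
  rintro t ht ⟨v, hv⟩
  by_cases hw : ∃ w ∈ t, w ≠ v ∧ ¬ G.Adj v w
  · obtain ⟨w, hw, _, _, hs⟩ := exists_simplicial hP t.card t le_rfl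
      (fun a ha b hb c hc d hd => h4 a (ht ha) b (ht hb) c (ht hc) d (ht hd))
      (fun a ha b hb c hc d hd e he => h5 a (ht ha) b (ht hb) c (ht hc) d (ht hd) e (ht he))
      (fun a ha b hb c hc d hd e he f hf => h6 a (ht ha) b (ht hb) c (ht hc) d (ht hd) e (ht he) f (ht hf))
      v hv hw
    exact ⟨w, hw, by convert clique_of_nbrs hw hs (hc.mono ht le_rfl)⟩
  · push Not at hw
    by_cases hs : ∀ a ∈ t, ∀ b ∈ t, G.Adj v a → G.Adj v b → a ≠ b → G.Adj a b
    · exact ⟨v, hv, by convert clique_of_nbrs hv hs (hc.mono ht le_rfl)⟩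
    · push Not at hs
      obtain ⟨a, ha, b, hb, _, _, hab, hnab⟩ := hs
      obtain ⟨w, hw, _, _, hs⟩ := exists_simplicial hP t.card t le_rfl
        (fun a ha b hb c hc d hd => h4 a (ht ha) b (ht hb) c (ht hc) d (ht hd))
        (fun a ha b hb c hc d hd e he => h5 a (ht ha) b (ht hb) c (ht hc) d (ht hd) e (ht he))
        (fun a ha b hb c hc d hd e he f hf => h6 a (ht ha) b (ht hb) c (ht hc) d (ht hd) e (ht he) f (ht hf))
        a ha ⟨b, hb, hab.symm, hnab⟩
      exact ⟨w, hw, by convert clique_of_nbrs hw hs (hc.mono ht le_rfl)⟩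

end basics

section c4
variable {V : Type*} {G : SimpleGraph V}

theorem exists_max_clique (s : Finset V) : ∃ K ⊆ s, G.IsClique (K : Set V) ∧ CB G s K.card := by
  classical
  obtain ⟨K, hK, hmax⟩ := Finset.exists_max_image
    (s.powerset.filter (fun K : Finset V => G.IsClique (K : Set V))) Finset.card ⟨∅, by simp⟩
  simp only [Finset.mem_filter, Finset.mem_powerset] at hK hmax
  exact ⟨K, hK.1, hK.2, fun Q hQ hc => hmax Q ⟨hQ, hc⟩⟩

open Classical in
theorem col_c4free (hP : NoP G) {s : Finset V} (h4 : NoC4 G s) {n : ℕ} (hn : 1 ≤ n)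
    (hc : CB G s n) : Col G s (2 * n - 1) := by
  obtain ⟨K, hKs, hK, hKmax⟩ := exists_max_clique (G := G) s
  have hKn : K.card ≤ n := hc K hKs hK
  rcases Nat.lt_or_ge K.card 2 with hK2 | hK2
  · refine ⟨fun _ => 0, fun v _ => by dsimp only; omega, fun u hu v hv huv => ?_⟩
    have := hKmax {u, v} (by intro x; simp; rintro (rfl | rfl) <;> assumption) (by
      simp [huv])
    rw [Finset.card_pair huv.ne] at this
    omega
  -- neighbours in K
  set NK : V → Finset V := fun x => K.filter (G.Adj x) with hNK
  have memNK : ∀ x k, k ∈ NK x ↔ k ∈ K ∧ G.Adj x k := by intro x k; simp [hNK]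
  have comp : ∀ x ∈ s, ∀ y ∈ s, x ∉ K → y ∉ K → G.Adj x y → NK x ⊆ NK y ∨ NK y ⊆ NK x := by
    intro x hx y hy hxK hyK hxy
    by_contra hcon
    push Not at hcon
    obtain ⟨h1, h2⟩ := hcon
    obtain ⟨a, ha, ha'⟩ := Finset.not_subset.1 h1
    obtain ⟨b, hb, hb'⟩ := Finset.not_subset.1 h2
    rw [memNK] at ha ha' hb hb'
    have hya : ¬ G.Adj y a := fun h => ha' ⟨ha.1, h⟩
    have hxb : ¬ G.Adj x b := fun h => hb' ⟨hb.1, h⟩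
    have hab : a ≠ b := by rintro rfl; exact hxb ha.2
    exact h4 x hx y hy b (hKs hb.1) a (hKs ha.1) hxy hb.2 (hK hb.1 ha.1 hab.symm) ha.2.symm
      (by rintro rfl; exact hxK hb.1) (by rintro rfl; exact hyK ha.1) hxb hya
  set A := s.filter (fun x => x ∉ K ∧ K.card - 1 ≤ (NK x).card) with hA
  set B := s.filter (fun x => x ∉ K ∧ (NK x).card + 2 ≤ K.card) with hB
  have hNKsub : ∀ x, NK x ⊆ K := fun x => Finset.filter_subset _ _
  have memA : ∀ x, x ∈ A ↔ x ∈ s ∧ x ∉ K ∧ K.card - 1 ≤ (NK x).card := by intro x; simp [hA]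
  have memB : ∀ x, x ∈ B ↔ x ∈ s ∧ x ∉ K ∧ (NK x).card + 2 ≤ K.card := by intro x; simp [hB]
  have colA : Col G A 1 := by
    refine ⟨fun _ => 0, fun _ _ => Nat.one_pos, fun x hx y hy hxy => ?_⟩
    exfalso
    rw [memA] at hx hy
    have key : ∀ x ∈ s, ∀ y ∈ s, x ∉ K → y ∉ K → G.Adj x y → NK x ⊆ NK y →
        K.card - 1 ≤ (NK x).card → False := by
      intro x hx y hy hxK hyK hxy hsub hcard
      have := hKmax (insert x (insert y (NK x))) (by
        intro z hz
        simp only [Finset.mem_insert] at hz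
        rcases hz with rfl | rfl | hz
        · exact hx
        · exact hy
        · exact hKs (hNKsub _ hz)) (by
        rw [Finset.coe_insert, Finset.coe_insert, SimpleGraph.isClique_insert,
          SimpleGraph.isClique_insert]
        refine ⟨⟨hK.subset (by exact_mod_cast hNKsub x), ?_⟩, ?_⟩
        · intro b hb _
          exact ((memNK _ _).1 (hsub hb)).2
        · intro b hb _
          rcases hb with rfl | hb
          · exact hxy
          · exact ((memNK _ _).1 hb).2)
      rw [Finset.card_insert_of_notMem, Finset.card_insert_of_notMem] at this
      · omega
      · exact fun h => hyK (hNKsub _ h)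
      · simp only [Finset.mem_insert, not_or]
        exact ⟨hxy.ne, fun h => hxK (hNKsub _ h)⟩
    rcases comp x hx.1 y hy.1 hx.2.1 hy.2.1 hxy with h | h
    · exact key x hx.1 y hy.1 hx.2.1 hy.2.1 hxy h hx.2.2
    · exact key y hy.1 x hx.1 hy.2.1 hx.2.1 hxy.symm h hy.2.2
  have colB : Col G (K ∪ B) (2 * K.card - 2) := by
    refine col_of_degen _ ?_
    intro t ht htne
    by_cases hB' : (t ∩ B).Nonempty
    · obtain ⟨y, hy, hymax⟩ := Finset.exists_max_image (t ∩ B) (fun y => (NK y).card) hB'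
      rw [Finset.mem_inter] at hy
      have hyB := (memB y).1 hy.2
      refine ⟨y, hy.1, ?_⟩
      have hsub : t.filter (G.Adj y) ⊆ NK y ∪ (t ∩ B).filter (G.Adj y) := by
        intro x hx
        simp only [Finset.mem_filter] at hx
        rcases Finset.mem_union.1 (ht hx.1) with h | h
        · exact Finset.mem_union_left _ ((memNK _ _).2 ⟨h, hx.2⟩)
        · exact Finset.mem_union_right _ (by simp [hx.1, h, hx.2])
      have hincl : ∀ x ∈ t ∩ B, G.Adj y x → NK x ⊆ NK y := by
        intro x hx hyx
        have h1 := hymax x hx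
        rw [Finset.mem_inter] at hx
        have hxB := (memB x).1 hx.2
        rcases comp y hyB.1 x hxB.1 hyB.2.1 hxB.2.1 hyx with h | h
        · exact (Finset.eq_of_subset_of_card_le h h1).ge
        · exact h
      have h2 : ((t ∩ B).filter (G.Adj y)).card < K.card := by
        refine clique_of_nbrs (Finset.mem_inter.2 hy) ?_ (hKmax.mono (fun x hx =>
          ((memB x).1 (Finset.mem_inter.1 hx).2).1) le_rfl)
        intro a ha b hb hya hyb hab
        by_contra hnab
        have ha' := hincl a ha hya
        have hb' := hincl b hb hyb
        have hcard : 2 ≤ (K \ NK y).card := by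
          rw [Finset.card_sdiff_of_subset (hNKsub y)]; omega
        obtain ⟨k, hk, l, hl, hkl⟩ := Finset.one_lt_card.1 hcard
        rw [Finset.mem_sdiff] at hk hl
        have miss : ∀ x, NK x ⊆ NK y → ∀ k ∈ K, k ∉ NK y → ¬ G.Adj x k := by
          intro x hx k hk hkn h
          exact hkn (hx ((memNK _ _).2 ⟨hk, h⟩))
        exact hP a y b k l hya.symm hyb (hK hk.1 hl.1 hkl) hab hnab
          (miss a ha' k hk.1 hk.2) (miss a ha' l hl.1 hl.2)
          (miss y subset_rfl k hk.1 hk.2) (miss y subset_rfl l hl.1 hl.2)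
          (miss b hb' k hk.1 hk.2) (miss b hb' l hl.1 hl.2)
      have h3 := (Finset.card_le_card hsub).trans (Finset.card_union_le _ _)
      have := hyB.2.2
      omega
    · obtain ⟨v, hv⟩ := htne
      have htK : t ⊆ K := by
        intro x hx
        rcases Finset.mem_union.1 (ht hx) with h | h
        · exact h
        · exact absurd ⟨x, Finset.mem_inter.2 ⟨hx, h⟩⟩ hB'
      refine ⟨v, hv, ?_⟩
      have h1 : t.filter (G.Adj v) ⊆ K.erase v := by
        intro x hx
        simp only [Finset.mem_filter] at hx
        exact Finset.mem_erase.2 ⟨hx.2.ne', htK hx.1⟩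
      have := Finset.card_le_card h1
      rw [Finset.card_erase_of_mem (htK hv)] at this
      omega
  refine (colA.union colB).mono ?_ (by omega)
  intro x hx
  by_cases hxK : x ∈ K
  · simp [hxK]
  · rcases Nat.lt_or_ge (NK x).card (K.card - 1) with h | h
    · exact Finset.mem_union_right _ (Finset.mem_union_right _ ((memB x).2 ⟨hx, hxK, by omega⟩))
    · exact Finset.mem_union_left _ ((memA x).2 ⟨hx, hxK, h⟩)

theorem NoC4.mono {s t : Finset V} (h : NoC4 G t) (ht : s ⊆ t) : NoC4 G s :=
  fun a ha b hb c hc d hd => h a (ht ha) b (ht hb) c (ht hc) d (ht hd)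
theorem NoC5.mono {s t : Finset V} (h : NoC5 G t) (ht : s ⊆ t) : NoC5 G s :=
  fun a ha b hb c hc d hd e he => h a (ht ha) b (ht hb) c (ht hc) d (ht hd) e (ht he)
theorem NoC6.mono {s t : Finset V} (h : NoC6 G t) (ht : s ⊆ t) : NoC6 G s :=
  fun a ha b hb c hc d hd e he f hf =>
    h a (ht ha) b (ht hb) c (ht hc) d (ht hd) e (ht he) f (ht hf)

end c4

section main2
variable {V : Type*} [Fintype V] {G : SimpleGraph V}

theorem card_insert_clique {w : ℕ} (hw : CB G Finset.univ w) (Q : Finset V)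
    (hQ : G.IsClique (Q : Set V)) (v : V) (hv : ∀ x ∈ Q, G.Adj v x) : Q.card + 1 ≤ w := by
  classical
  have := hw (insert v Q) (Finset.subset_univ _) (by
    rw [Finset.coe_insert, SimpleGraph.isClique_insert]
    exact ⟨hQ, fun b hb _ => hv b hb⟩)
  rwa [Finset.card_insert_of_notMem (fun h => G.loopless.irrefl _ (hv v h))] at this

open Classical in
/-- the neighbourhood as a finset -/
noncomputable def Nb (G : SimpleGraph V) (v : V) : Finset V := Finset.univ.filter (G.Adj v)

theorem mem_Nb {v x : V} : x ∈ Nb G v ↔ G.Adj v x := by simp [Nb]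

theorem noC4_Nb (hW : NoW G) (v : V) : NoC4 G (Nb G v) := by
  intro a ha b hb c hc d hd h1 h2 h3 h4 h5 h6 h7 h8
  rw [mem_Nb] at ha hb hc hd
  exact hW a b c d v h1 h2 h3 h4 h5 h6 h7 h8 ha hb hc hd

open Classical in
theorem case_chordal (hP : NoP G) (hW : NoW G) (h5 : ∀ v, NoC5 G (Nb G v))
    (h6 : ∀ v, NoC6 G (Nb G v)) {w : ℕ} (hw : CB G Finset.univ w) {u v : V} (huv : G.Adj u v) :
    Col G Finset.univ (2 * w) := by
  set L := Finset.univ.filter (fun x => x = u ∨ x = v ∨ (¬ G.Adj u x ∧ ¬ G.Adj v x)) with hL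
  have memL : ∀ x, x ∈ L ↔ x = u ∨ x = v ∨ (¬ G.Adj u x ∧ ¬ G.Adj v x) := by intro x; simp [hL]
  set D := Finset.univ.filter (fun x => x ≠ u ∧ G.Adj v x ∧ ¬ G.Adj u x) with hD
  have memD : ∀ x, x ∈ D ↔ x ≠ u ∧ G.Adj v x ∧ ¬ G.Adj u x := by intro x; simp [hD]
  have hnu : ∀ x ∈ L, G.Adj u x → x = v := by
    intro x hx h
    rcases (memL x).1 hx with rfl | h' | h'
    · exact absurd h (G.loopless.irrefl _)
    · exact h'
    · exact absurd h h'.1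
  have hnv : ∀ x ∈ L, G.Adj v x → x = u := by
    intro x hx h
    rcases (memL x).1 hx with h' | rfl | h'
    · exact h'
    · exact absurd h (G.loopless.irrefl _)
    · exact absurd h h'.2
  have hLP : ∀ x ∈ L, ∀ a ∈ L, ∀ b ∈ L, G.Adj x a → G.Adj x b → a ≠ b → G.Adj a b := by
    intro x hx a ha b hb hxa hxb hab
    by_contra hnab
    have nn : ∀ y ∈ L, y ≠ u → y ≠ v → ¬ G.Adj y u ∧ ¬ G.Adj y v := by
      intro y hy h1 h2
      exact ⟨fun h => h2 (hnu y hy h.symm), fun h => h1 (hnv y hy h.symm)⟩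
    by_cases hxu : x = u
    · subst hxu; exact hab ((hnu a ha hxa).trans (hnu b hb hxb).symm)
    by_cases hxv : x = v
    · subst hxv; exact hab ((hnv a ha hxa).trans (hnv b hb hxb).symm)
    have hau : a ≠ u := by rintro rfl; exact (nn x hx hxu hxv).1 hxa
    have hav : a ≠ v := by rintro rfl; exact (nn x hx hxu hxv).2 hxa
    have hbu : b ≠ u := by rintro rfl; exact (nn x hx hxu hxv).1 hxb
    have hbv : b ≠ v := by rintro rfl; exact (nn x hx hxu hxv).2 hxb
    exact hP a x b u v hxa.symm hxb huv hab hnab (nn a ha hau hav).1 (nn a ha hau hav).2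
      (nn x hx hxu hxv).1 (nn x hx hxu hxv).2 (nn b hb hbu hbv).1 (nn b hb hbu hbv).2
  obtain ⟨Q, hQL, hQ, hQmax⟩ := exists_max_clique (G := G) L
  have colL : Col G L Q.card := col_of_p3free hLP hQmax
  have hw2 : 2 ≤ w := by
    have := hw {u, v} (Finset.subset_univ _) (by simp [huv])
    rwa [Finset.card_pair huv.ne] at this
  have hQw : Q.card ≤ w := hw Q (Finset.subset_univ _) hQ
  have colU : Col G (Nb G u) (w - 1) := by
    refine col_chordal hP (noC4_Nb hW u) (h5 u) (h6 u) ?_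
    intro Q' hQ' hc
    have := card_insert_clique hw Q' hc u (fun x hx => mem_Nb.1 (hQ' hx))
    omega
  have hDN : D ⊆ Nb G v := fun x hx => mem_Nb.2 ((memD x).1 hx).2.1
  have colD : ∀ k, CB G D k → Col G D k := fun k hk =>
    col_chordal hP ((noC4_Nb hW v).mono hDN) ((h5 v).mono hDN) ((h6 v).mono hDN) hk
  have cover : (Finset.univ : Finset V) ⊆ L ∪ Nb G u ∪ D := by
    intro x _
    simp only [Finset.mem_union, memL, memD, mem_Nb]
    tauto
  rcases Nat.lt_or_ge Q.card 3 with hk | hk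
  · have cD : CB G D (w - 1) := by
      intro Q' hQ' hc
      have := card_insert_clique hw Q' hc v (fun x hx => mem_Nb.1 (hDN (hQ' hx)))
      omega
    exact ((colL.union colU).union (colD _ cD)).mono cover (by omega)
  · have hQu : u ∉ Q := by
      intro hu
      have : Q ⊆ {u, v} := by
        intro x hx
        by_cases hxu : x = u
        · simp [hxu]
        · simp [hnu x (hQL hx) (hQ hu hx (Ne.symm hxu))]
      have := (Finset.card_le_card this).trans Finset.card_le_two
      omega
    have hQv : v ∉ Q := by
      intro hv
      have : Q ⊆ {u, v} := by
        intro x hx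
        by_cases hxv : x = v
        · simp [hxv]
        · simp [hnv x (hQL hx) (hQ hv hx (Ne.symm hxv))]
      have := (Finset.card_le_card this).trans Finset.card_le_two
      omega
    have hQA : ∀ q ∈ Q, ¬ G.Adj u q ∧ ¬ G.Adj v q := by
      intro q hq
      exact ⟨fun h => hQv (hnu q (hQL hq) h ▸ hq), fun h => hQu (hnv q (hQL hq) h ▸ hq)⟩
    -- each vertex of D misses at most one vertex of Q
    have miss1 : ∀ y ∈ D, ∀ p ∈ Q, ∀ q ∈ Q, p ≠ q → ¬ G.Adj y p → ¬ G.Adj y q → False := by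
      intro y hy p hp q hq hpq h1 h2
      obtain ⟨hyu, hvy, huy⟩ := (memD y).1 hy
      exact hP y v u p q hvy.symm huv.symm (hQ hp hq hpq) hyu (fun h => huy h.symm) h1 h2
        (hQA p hp).2 (hQA q hq).2 (hQA p hp).1 (hQA q hq).1
    have cD : CB G D (w + 1 - Q.card) := by
      intro C hC hCc
      have hdisj : ∀ y ∈ C, y ∉ Q := by
        intro y hy hyQ
        exact (hQA y hyQ).2 ((memD y).1 (hC hy)).2.1
      -- all misses are at a single vertex
      have single : ∃ q ∈ Q, ∀ y ∈ C, ∀ p ∈ Q, p ≠ q → G.Adj y p := by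
        by_cases hm : ∃ y ∈ C, ∃ q ∈ Q, ¬ G.Adj y q
        · obtain ⟨y, hy, q, hq, hyq⟩ := hm
          refine ⟨q, hq, ?_⟩
          intro z hz p hp hpq
          by_contra hzp
          have hyp : G.Adj y p := by
            by_contra h; exact miss1 y (hC hy) p hp q hq hpq h hyq
          have hyz : y ≠ z := by rintro rfl; exact hzp hyp
          have hzq : G.Adj z q := by
            by_contra h; exact miss1 z (hC hz) p hp q hq hpq hzp h
          obtain ⟨r, hr⟩ : ((Q.erase p).erase q).Nonempty := by
            rw [← Finset.card_pos, Finset.card_erase_of_mem (Finset.mem_erase.2 ⟨hpq.symm, hq⟩),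
              Finset.card_erase_of_mem hp]
            omega
          simp only [Finset.mem_erase] at hr
          obtain ⟨hrq, hrp, hrQ⟩ := hr
          have hyr : G.Adj y r := by
            by_contra h; exact miss1 y (hC hy) r hrQ q hq hrq h hyq
          have hzr : G.Adj z r := by
            by_contra h; exact miss1 z (hC hz) r hrQ p hp hrp h hzp
          exact hW y z q p r (hCc hy hz hyz) hzq (hQ hq hp hpq.symm) hyp.symm
            (by rintro rfl; exact hdisj _ hy hq) (by rintro rfl; exact hdisj _ hz hp) hyq hzp
            hyr.symm hzr.symm (hQ hrQ hq hrq) (hQ hrQ hp hrp)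
        · push Not at hm
          obtain ⟨q, hq⟩ : Q.Nonempty := Finset.card_pos.1 (by omega)
          exact ⟨q, hq, fun y hy p hp _ => hm y hy p hp⟩
      obtain ⟨q, hq, hall⟩ := single
      have := hw (C ∪ Q.erase q) (Finset.subset_univ _) (by
        intro a ha b hb hab
        simp only [Finset.coe_union, Set.mem_union, Finset.mem_coe, Finset.mem_erase] at ha hb
        rcases ha with ha | ha <;> rcases hb with hb | hb
        · exact hCc ha hb hab
        · exact hall a ha b hb.2 hb.1
        · exact (hall b hb a ha.2 ha.1).symm
        · exact hQ ha.2 hb.2 hab)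
      rw [Finset.card_union_of_disjoint, Finset.card_erase_of_mem hq] at this
      · omega
      · rw [Finset.disjoint_left]
        intro y hy hyQ
        exact hdisj y hy (Finset.mem_of_mem_erase hyQ)
    exact ((colL.union colU).union (colD _ cD)).mono cover (by omega)

end main2

set_option linter.unusedSectionVars false
section c5
variable {V : Type*} [Fintype V] {G : SimpleGraph V}

theorem IsC5.rot {a b c d e : V} (h : IsC5 G a b c d e) : IsC5 G b c d e a := by
  obtain ⟨h1, h2, h3, h4, h5, h6, h7, h8, h9, h10⟩ := h
  exact ⟨h2, h3, h4, h5, h1, h7, h8, h9, h10, h6⟩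

theorem IsC5.refl {a b c d e : V} (h : IsC5 G a b c d e) : IsC5 G a e d c b := by
  obtain ⟨h1, h2, h3, h4, h5, h6, h7, h8, h9, h10⟩ := h
  exact ⟨h5.symm, h4.symm, h3.symm, h2.symm, h1.symm, fun h => h9 h.symm, fun h => h8 h.symm,
    fun h => h7 h.symm, fun h => h6 h.symm, fun h => h10 h.symm⟩

/-- data about a large clique `Q` in a set `M` -/
structure BigClique (G : SimpleGraph V) (M Q : Finset V) : Prop where
  sub : Q ⊆ M
  clique : G.IsClique (Q : Set V)
  max : CB G M Q.card

theorem BigClique.two {M Q : Finset V} (h : BigClique G M Q) {c c' : V} (hc : c ∈ M) (hc' : c' ∈ M)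
    (hcQ : c ∉ Q) (hcQ' : c' ∉ Q) (hcc : G.Adj c c')
    (hs : ∀ q ∈ Q, G.Adj c' q → G.Adj c q) :
    ∃ p ∈ Q, ∃ q ∈ Q, p ≠ q ∧ ¬ G.Adj c' p ∧ ¬ G.Adj c' q := by
  classical
  have h1 := h.max (insert c (insert c' (Q.filter (G.Adj c')))) (by
    intro z hz
    simp only [Finset.mem_insert, Finset.mem_filter] at hz
    rcases hz with rfl | rfl | hz
    · exact hc
    · exact hc'
    · exact h.sub hz.1) (by
    rw [Finset.coe_insert, Finset.coe_insert, SimpleGraph.isClique_insert,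
      SimpleGraph.isClique_insert]
    refine ⟨⟨h.clique.subset (by intro z hz; simp at hz; exact hz.1), ?_⟩, ?_⟩
    · intro b hb _
      simp at hb
      exact hb.2
    · intro b hb _
      rcases hb with rfl | hb
      · exact hcc
      · simp at hb
        exact hs b hb.1 hb.2)
  rw [Finset.card_insert_of_notMem, Finset.card_insert_of_notMem] at h1
  · have h2 := Finset.card_filter_add_card_filter_not (s := Q) (G.Adj c')
    have h3 : 1 < (Q.filter (fun x => ¬ G.Adj c' x)).card := by omega
    obtain ⟨p, hp, q, hq, hpq⟩ := Finset.one_lt_card.1 h3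
    simp only [Finset.mem_filter] at hp hq
    exact ⟨p, hp.1, q, hq.1, hpq, hp.2, hq.2⟩
  · simp [hcQ']
  · simp [hcQ, hcc.ne]

theorem BigClique.one {M Q : Finset V} (h : BigClique G M Q) {c : V} (hc : c ∈ M)
    (hcQ : c ∉ Q) : ∃ p ∈ Q, ¬ G.Adj c p := by
  classical
  by_contra hcon
  push Not at hcon
  have h1 := h.max (insert c Q) (by
    intro z hz
    simp only [Finset.mem_insert] at hz
    rcases hz with rfl | hz
    · exact hc
    · exact h.sub hz) (by
    rw [Finset.coe_insert, SimpleGraph.isClique_insert]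
    exact ⟨h.clique, fun b hb _ => hcon b hb⟩)
  rw [Finset.card_insert_of_notMem hcQ] at h1
  omega

theorem BigClique.comp {M Q : Finset V} (h : BigClique G M Q) (h4 : NoC4 G M) {c c' : V}
    (hc : c ∈ M) (hc' : c' ∈ M) (hcQ : c ∉ Q) (hcQ' : c' ∉ Q) (hcc : G.Adj c c') :
    (∀ q ∈ Q, G.Adj c q → G.Adj c' q) ∨ (∀ q ∈ Q, G.Adj c' q → G.Adj c q) := by
  by_contra hcon
  push Not at hcon
  obtain ⟨⟨p, hp, h1, h2⟩, ⟨q, hq, h3, h5⟩⟩ := hcon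
  have hpq : p ≠ q := by rintro rfl; exact h2 h3
  exact h4 c hc c' hc' q (h.sub hq) p (h.sub hp) hcc h3 (h.clique hq hp hpq.symm) h1.symm
    (by rintro rfl; exact hcQ hq) (by rintro rfl; exact hcQ' hp) h5 h2

theorem core5 (hP : NoP G) {M Q : Finset V} (h : BigClique G M Q) (h4 : NoC4 G M)
    (h6 : NoC6 G M) {c0 c1 c2 c3 c4 : V} (hC : IsC5 G c0 c1 c2 c3 c4)
    (m0 : c0 ∈ M) (m1 : c1 ∈ M) (m2 : c2 ∈ M) (m3 : c3 ∈ M) (m4 : c4 ∈ M)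
    (n0 : c0 ∉ Q) (n1 : c1 ∉ Q) (n2 : c2 ∉ Q) (n3 : c3 ∉ Q) (n4 : c4 ∉ Q)
    (s10 : ∀ q ∈ Q, G.Adj c1 q → G.Adj c0 q) (s40 : ∀ q ∈ Q, G.Adj c4 q → G.Adj c0 q)
    (s32 : ∀ q ∈ Q, G.Adj c3 q → G.Adj c2 q) : False := by
  obtain ⟨a01, a12, a23, a34, a40, b02, b13, b24, b30, b41⟩ := hC
  have x02 : c0 ≠ c2 := by rintro rfl; exact b30 a23.symm
  have x13 : c1 ≠ c3 := by rintro rfl; exact b41 a34.symm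
  have x41 : c4 ≠ c1 := by rintro rfl; exact b13 a34.symm
  obtain ⟨p, hp, p', hp', hpp, np, np'⟩ := h.two m0 m1 n0 n1 a01 s10
  rcases h.comp h4 m1 m2 n1 n2 a12 with s12 | s21
  swap
  · have t : ∀ q ∈ Q, ¬ G.Adj c1 q → ¬ G.Adj c2 q ∧ ¬ G.Adj c3 q := fun q hq hn =>
      ⟨fun hh => hn (s21 q hq hh), fun hh => hn (s21 q hq (s32 q hq hh))⟩
    exact hP c1 c2 c3 p p' a12 a23 (h.clique hp hp' hpp) x13 b13 np np' (t p hp np).1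
      (t p' hp' np').1 (t p hp np).2 (t p' hp' np').2
  obtain ⟨q0, hq0, nq0⟩ := h.one m0 n0
  obtain ⟨q2, hq2, nq2⟩ := h.one m2 n2
  have u0 : ∀ q ∈ Q, ¬ G.Adj c0 q → q = q0 := by
    intro q hq hn
    by_contra hne
    exact hP c4 c0 c1 q q0 a40 a01 (h.clique hq hq0 hne) x41 b41
      (fun hh => hn (s40 _ hq hh)) (fun hh => nq0 (s40 _ hq0 hh)) hn nq0
      (fun hh => hn (s10 _ hq hh)) (fun hh => nq0 (s10 _ hq0 hh))
  have u2 : ∀ q ∈ Q, ¬ G.Adj c2 q → q = q2 := by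
    intro q hq hn
    by_contra hne
    exact hP c1 c2 c3 q q2 a12 a23 (h.clique hq hq2 hne) x13 b13
      (fun hh => hn (s12 _ hq hh)) (fun hh => nq2 (s12 _ hq2 hh)) hn nq2
      (fun hh => hn (s32 _ hq hh)) (fun hh => nq2 (s32 _ hq2 hh))
  have u1 : ∀ q ∈ Q, ¬ G.Adj c1 q → q = q0 ∨ q = q2 := by
    intro q hq hn
    by_cases hq0' : G.Adj c0 q
    · by_cases hq2' : G.Adj c2 q
      · exact (h4 q (h.sub hq) c0 m0 c1 m1 c2 m2 hq0'.symm a01 a12 hq2'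
          (by rintro rfl; exact n1 hq) x02 (fun hh => hn hh.symm) b02).elim
      · exact Or.inr (u2 q hq hq2')
    · exact Or.inl (u0 q hq hq0')
  have q02 : q0 ≠ q2 := by
    rintro rfl
    have e1 := u1 p hp np
    have e2 := u1 p' hp' np'
    simp only [or_self] at e1 e2
    exact hpp (e1.trans e2.symm)
  have q0c2 : G.Adj c2 q0 := by by_contra hn; exact q02 (u2 q0 hq0 hn)
  have q2c0 : G.Adj c0 q2 := by by_contra hn; exact q02 (u0 q2 hq2 hn).symm
  have q0c1 : ¬ G.Adj c1 q0 := fun hh => nq0 (s10 _ hq0 hh)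
  have q2c1 : ¬ G.Adj c1 q2 := fun hh => nq2 (s12 _ hq2 hh)
  have q0c4 : ¬ G.Adj c4 q0 := fun hh => nq0 (s40 _ hq0 hh)
  have q2c3 : ¬ G.Adj c3 q2 := fun hh => nq2 (s32 _ hq2 hh)
  have q0q2 : G.Adj q0 q2 := h.clique hq0 hq2 q02
  have hex : ¬ (¬ G.Adj c4 q2 ∧ ¬ G.Adj c3 q0) := by
    rintro ⟨e1, e2⟩
    exact h6 c0 m0 q2 (h.sub hq2) q0 (h.sub hq0) c2 m2 c3 m3 c4 m4
      ⟨q2c0, q0q2.symm, q0c2.symm, a23, a34, a40, nq0, fun hh => nq2 hh.symm, fun hh => e2 hh.symm,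
        b24, b30, e1, b02, fun hh => q2c3 hh.symm, fun hh => q0c4 hh.symm⟩
  have other : ∀ q ∈ Q, q ≠ q0 → q ≠ q2 → G.Adj c1 q := by
    intro q hq e1 e2
    by_contra hn
    rcases u1 q hq hn with hh | hh
    · exact e1 hh
    · exact e2 hh
  rcases h.comp h4 m3 m4 n3 n4 a34 with s34 | s43
  · have q0c3 : ¬ G.Adj c3 q0 := fun hh => q0c4 (s34 _ hq0 hh)
    have q2c4 : G.Adj c4 q2 := by by_contra hn; exact hex ⟨hn, q0c3⟩
    obtain ⟨r, hr, r', hr', hrr, nr, nr'⟩ := h.two m0 m4 n0 n4 a40.symm s40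
    have fin : ∀ r ∈ Q, ¬ G.Adj c4 r → r ≠ q0 → False := by
      intro r hr nr hne
      have c1r := other r hr hne (by rintro rfl; exact nr q2c4)
      exact hP q0 r c1 c3 c4 (h.clique hq0 hr hne.symm) c1r.symm a34
        (by rintro rfl; exact n1 hq0) (fun hh => q0c1 hh.symm) (fun hh => q0c3 hh.symm)
        (fun hh => q0c4 hh.symm) (fun hh => nr (s34 _ hr hh.symm)) (fun hh => nr hh.symm) b13
        (fun hh => b41 hh.symm)
    by_cases hr0 : r = q0
    · exact fin r' hr' nr' (by rw [← hr0]; exact hrr.symm)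
    · exact fin r hr nr hr0
  · have q2c4 : ¬ G.Adj c4 q2 := fun hh => q2c3 (s43 _ hq2 hh)
    have q0c3 : G.Adj c3 q0 := by by_contra hn; exact hex ⟨q2c4, hn⟩
    obtain ⟨r, hr, r', hr', hrr, nr, nr'⟩ := h.two m2 m3 n2 n3 a23 s32
    have fin : ∀ r ∈ Q, ¬ G.Adj c3 r → r ≠ q2 → False := by
      intro r hr nr hne
      have c1r := other r hr (by rintro rfl; exact nr q0c3) hne
      exact hP q2 r c1 c3 c4 (h.clique hq2 hr hne.symm) c1r.symm a34
        (by rintro rfl; exact n1 hq2) (fun hh => q2c1 hh.symm) (fun hh => q2c3 hh.symm)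
        (fun hh => q2c4 hh.symm) (fun hh => nr hh.symm) (fun hh => nr (s43 _ hr hh.symm)) b13
        (fun hh => b41 hh.symm)
    by_cases hr0 : r = q2
    · exact fin r' hr' nr' (by rw [← hr0]; exact hrr.symm)
    · exact fin r hr nr hr0

theorem core5' (hP : NoP G) {M Q : Finset V} (h : BigClique G M Q) (h4 : NoC4 G M)
    (h6 : NoC6 G M) {c0 c1 c2 c3 c4 : V} (hC : IsC5 G c0 c1 c2 c3 c4)
    (m0 : c0 ∈ M) (m1 : c1 ∈ M) (m2 : c2 ∈ M) (m3 : c3 ∈ M) (m4 : c4 ∈ M)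
    (n0 : c0 ∉ Q) (n1 : c1 ∉ Q) (n2 : c2 ∉ Q) (n3 : c3 ∉ Q) (n4 : c4 ∉ Q)
    (s10 : ∀ q ∈ Q, G.Adj c1 q → G.Adj c0 q) (s40 : ∀ q ∈ Q, G.Adj c4 q → G.Adj c0 q) :
    False := by
  rcases h.comp h4 m2 m3 n2 n3 hC.2.2.1 with s | s
  · exact core5 hP h h4 h6 hC.refl m0 m4 m3 m2 m1 n0 n4 n3 n2 n1 s40 s10 s
  · exact core5 hP h h4 h6 hC m0 m1 m2 m3 m4 n0 n1 n2 n3 n4 s10 s40 s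

theorem core5'' (hP : NoP G) {M Q : Finset V} (h : BigClique G M Q) (h4 : NoC4 G M)
    (h6 : NoC6 G M) {c0 c1 c2 c3 c4 : V} (hC : IsC5 G c0 c1 c2 c3 c4)
    (m0 : c0 ∈ M) (m1 : c1 ∈ M) (m2 : c2 ∈ M) (m3 : c3 ∈ M) (m4 : c4 ∈ M)
    (n0 : c0 ∉ Q) (n1 : c1 ∉ Q) (n2 : c2 ∉ Q) (n3 : c3 ∉ Q) (n4 : c4 ∉ Q) : False := by
  have k0 := core5' hP h h4 h6 hC m0 m1 m2 m3 m4 n0 n1 n2 n3 n4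
  have k1 := core5' hP h h4 h6 hC.rot m1 m2 m3 m4 m0 n1 n2 n3 n4 n0
  have k2 := core5' hP h h4 h6 hC.rot.rot m2 m3 m4 m0 m1 n2 n3 n4 n0 n1
  have k3 := core5' hP h h4 h6 hC.rot.rot.rot m3 m4 m0 m1 m2 n3 n4 n0 n1 n2
  have k4 := core5' hP h h4 h6 hC.rot.rot.rot.rot m4 m0 m1 m2 m3 n4 n0 n1 n2 n3
  have t0 := h.comp h4 m0 m1 n0 n1 hC.1
  have t1 := h.comp h4 m1 m2 n1 n2 hC.2.1
  have t2 := h.comp h4 m2 m3 n2 n3 hC.2.2.1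
  have t3 := h.comp h4 m3 m4 n3 n4 hC.2.2.2.1
  have t4 := h.comp h4 m4 m0 n4 n0 hC.2.2.2.2.1
  rcases t0 with t0 | t0
  · rcases t1 with t1 | t1
    · rcases t2 with t2 | t2
      · rcases t3 with t3 | t3
        · rcases t4 with t4 | t4
          · exact k0 (fun q hq hh => t4 q hq (t3 q hq (t2 q hq (t1 q hq hh)))) t4
          · exact k4 t4 t3
        · exact k3 t3 t2
      · exact k2 t2 t1
    · exact k1 t1 t0
  · rcases t4 with t4 | t4
    · exact k0 t0 t4
    · rcases t3 with t3 | t3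
      · exact k4 t4 t3
      · rcases t2 with t2 | t2
        · exact k3 t3 t2
        · rcases t1 with t1 | t1
          · exact k2 t2 t1
          · exact k1 t1 (fun q hq hh => t1 q hq (t2 q hq (t3 q hq (t4 q hq hh))))

open Classical in
theorem col_three {s : Finset V} (S0 S1 S2 : V → Prop)
    (cov : ∀ v ∈ s, S0 v ∨ S1 v ∨ S2 v)
    (k0 : ∀ u v, S0 u → S0 v → ¬ G.Adj u v) (k1 : ∀ u v, S1 u → S1 v → ¬ G.Adj u v)
    (k2 : ∀ u v, S2 u → S2 v → ¬ G.Adj u v) : Col G s 3 := by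
  refine ⟨fun v => if S0 v then 0 else if S1 v then 1 else 2, ?_, ?_⟩
  · intro v _
    dsimp only
    split_ifs <;> omega
  · intro u hu v hv huv
    have cu := cov u hu
    have cv := cov v hv
    have e0 := k0 u v
    have e1 := k1 u v
    have e2 := k2 u v
    dsimp only
    split_ifs <;> first | omega | tauto

open Classical in
theorem col_two {s : Finset V} (S0 S1 : V → Prop)
    (cov : ∀ v ∈ s, S0 v ∨ S1 v)
    (k0 : ∀ u v, S0 u → S0 v → ¬ G.Adj u v) (k1 : ∀ u v, S1 u → S1 v → ¬ G.Adj u v) :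
    Col G s 2 := by
  refine ⟨fun v => if S0 v then 0 else 1, ?_, ?_⟩
  · intro v _
    dsimp only
    split_ifs <;> omega
  · intro u hu v hv huv
    have cu := cov u hu
    have cv := cov v hv
    have e0 := k0 u v
    have e1 := k1 u v
    dsimp only
    split_ifs <;> first | omega | tauto

open Classical in
theorem col_five {s : Finset V} (S0 S1 S2 S3 S4 : V → Prop)
    (cov : ∀ v ∈ s, S0 v ∨ S1 v ∨ S2 v ∨ S3 v ∨ S4 v)
    (k0 : ∀ u v, S0 u → S0 v → ¬ G.Adj u v) (k1 : ∀ u v, S1 u → S1 v → ¬ G.Adj u v)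
    (k2 : ∀ u v, S2 u → S2 v → ¬ G.Adj u v) (k3 : ∀ u v, S3 u → S3 v → ¬ G.Adj u v)
    (k4 : ∀ u v, S4 u → S4 v → ¬ G.Adj u v) : Col G s 5 := by
  have h1 : Col G (s.filter (fun v => S0 v ∨ S1 v ∨ S2 v)) 3 :=
    col_three S0 S1 S2 (fun v hv => (Finset.mem_filter.1 hv).2) k0 k1 k2
  have h2 : Col G (s.filter (fun v => S3 v ∨ S4 v)) 2 :=
    col_two S3 S4 (fun v hv => (Finset.mem_filter.1 hv).2) k3 k4
  refine (h1.union h2).mono ?_ le_rfl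
  intro v hv
  have := cov v hv
  simp only [Finset.mem_union, Finset.mem_filter, hv, true_and]
  tauto

/-- vertices missing two nonadjacent neighbours of `h` -/
theorem st_class (hP : NoP G) {h a b : V} (ha : G.Adj h a) (hb : G.Adj h b) (hab : a ≠ b)
    (hnab : ¬ G.Adj a b) (u v : V)
    (hu : ¬ G.Adj a u ∧ ¬ G.Adj b u ∧ (u = a ∨ u = b ∨ ¬ G.Adj h u))
    (hv : ¬ G.Adj a v ∧ ¬ G.Adj b v ∧ (v = a ∨ v = b ∨ ¬ G.Adj h v)) : ¬ G.Adj u v := by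
  intro huv
  obtain ⟨u1, u2, rfl | rfl | u3⟩ := hu
  · exact hv.1 huv
  · exact hv.2.1 huv
  obtain ⟨v1, v2, rfl | rfl | v3⟩ := hv
  · exact u1 huv.symm
  · exact u2 huv.symm
  exact hP a h b u v ha.symm hb huv hab hnab u1 v1 u3 v3 u2 v2

theorem st_class' (hP : NoP G) {h a b : V} (ha : G.Adj h a) (hb : G.Adj h b) (hab : a ≠ b)
    (hnab : ¬ G.Adj a b) (u v : V)
    (hu : u = h ∨ (¬ G.Adj a u ∧ ¬ G.Adj b u ∧ ¬ G.Adj h u))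
    (hv : v = h ∨ (¬ G.Adj a v ∧ ¬ G.Adj b v ∧ ¬ G.Adj h v)) : ¬ G.Adj u v := by
  intro huv
  obtain rfl | ⟨u1, u2, u3⟩ := hu
  · rcases hv with rfl | hv
    · exact huv.ne rfl
    · exact hv.2.2 huv
  obtain rfl | ⟨v1, v2, v3⟩ := hv
  · exact u3 huv.symm
  exact hP a h b u v ha.symm hb huv hab hnab u1 v1 u3 v3 u2 v2

theorem key5 (hW : NoW G) {h c0 c1 c2 c3 c4 : V} (hC : IsC5 G c0 c1 c2 c3 c4)
    (m0 : G.Adj h c0) (m1 : G.Adj h c1) (m2 : G.Adj h c2) (m3 : G.Adj h c3) (m4 : G.Adj h c4)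
    (x02 : c0 ≠ c2) (x13 : c1 ≠ c3) (x41 : c4 ≠ c1) (x24 : c2 ≠ c4) (x30 : c3 ≠ c0)
    (x : V) (hx : ¬ G.Adj h x) (hxh : x ≠ h) :
    (¬ G.Adj c1 x ∧ ¬ G.Adj c4 x) ∨ (¬ G.Adj c2 x ∧ ¬ G.Adj c0 x) ∨
    (¬ G.Adj c3 x ∧ ¬ G.Adj c1 x) ∨ (¬ G.Adj c4 x ∧ ¬ G.Adj c2 x) ∨
    (¬ G.Adj c0 x ∧ ¬ G.Adj c3 x) := by
  obtain ⟨a01, a12, a23, a34, a40, b02, b13, b24, b30, b41⟩ := hC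
  have nocons : ∀ a b c, G.Adj h a → G.Adj h b → G.Adj h c → G.Adj a b → G.Adj b c → a ≠ c →
      ¬ G.Adj a c → ¬ (G.Adj a x ∧ G.Adj b x ∧ G.Adj c x) := by
    rintro a b c ha hb hc hab hbc hac hnac ⟨h1, h2, h3⟩
    exact hW a h c x b ha.symm hc h3 h1.symm hac hxh.symm hnac hx hab.symm hb.symm hbc h2
  have k0 := nocons c0 c1 c2 m0 m1 m2 a01 a12 x02 b02
  have k1 := nocons c1 c2 c3 m1 m2 m3 a12 a23 x13 b13
  have k2 := nocons c2 c3 c4 m2 m3 m4 a23 a34 x24 b24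
  have k3 := nocons c3 c4 c0 m3 m4 m0 a34 a40 x30 b30
  have k4 := nocons c4 c0 c1 m4 m0 m1 a40 a01 x41 b41
  clear nocons
  generalize G.Adj c0 x = p0 at *
  generalize G.Adj c1 x = p1 at *
  generalize G.Adj c2 x = p2 at *
  generalize G.Adj c3 x = p3 at *
  generalize G.Adj c4 x = p4 at *
  clear a01 a12 a23 a34 a40 b02 b13 b24 b30 b41 m0 m1 m2 m3 m4
  by_cases p0 <;> by_cases p1 <;> by_cases p2 <;> by_cases p3 <;> by_cases p4 <;> simp_all

open Classical in
theorem case_c5 (hP : NoP G) (hW : NoW G) (h : V) (h6 : NoC6 G (Nb G h))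
    {c0 c1 c2 c3 c4 : V} (hC : IsC5 G c0 c1 c2 c3 c4)
    (m0 : G.Adj h c0) (m1 : G.Adj h c1) (m2 : G.Adj h c2) (m3 : G.Adj h c3) (m4 : G.Adj h c4)
    {w : ℕ} (hw : CB G Finset.univ w) : Col G Finset.univ (2 * w) := by
  have hw3 : 3 ≤ w := by
    have := card_insert_clique hw {c0, c1} (by simp [hC.1]) h (by simp [m0, m1])
    rwa [Finset.card_pair hC.1.ne] at this
  set H : Finset V := {c0, c1, c2, c3, c4} with hH
  set Y := Nb G h \ H with hY
  have hYN : Y ⊆ Nb G h := Finset.sdiff_subset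
  have hM : CB G (Nb G h) (w - 1) := by
    intro Q' hQ' hc
    have := card_insert_clique hw Q' hc h (fun x hx => mem_Nb.1 (hQ' hx))
    omega
  have cY : CB G Y (w - 2) := by
    intro Q hQ hc
    by_contra hcon
    have hQc : Q.card = w - 1 := by
      have := hM Q (hQ.trans hYN) hc
      omega
    have nm : ∀ c ∈ H, c ∉ Q := fun c hc hcQ => (Finset.mem_sdiff.1 (hQ hcQ)).2 hc
    exact core5'' hP ⟨hQ.trans hYN, hc, by rw [hQc]; exact hM⟩ (noC4_Nb hW h) h6 hC
      (mem_Nb.2 m0) (mem_Nb.2 m1) (mem_Nb.2 m2) (mem_Nb.2 m3) (mem_Nb.2 m4)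
      (nm _ (by simp [hH])) (nm _ (by simp [hH])) (nm _ (by simp [hH])) (nm _ (by simp [hH]))
      (nm _ (by simp [hH]))
  have colY : Col G Y (2 * (w - 2) - 1) :=
    col_c4free hP ((noC4_Nb hW h).mono hYN) (by omega) cY
  obtain ⟨a01, a12, a23, a34, a40, b02, b13, b24, b30, b41⟩ := id hC
  have x02 : c0 ≠ c2 := by rintro rfl; exact b30 a23.symm
  have x13 : c1 ≠ c3 := by rintro rfl; exact b41 a34.symm
  have x41 : c4 ≠ c1 := by rintro rfl; exact b13 a34.symm
  have x24 : c2 ≠ c4 := by rintro rfl; exact b02 a40.symm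
  have x30 : c3 ≠ c0 := by rintro rfl; exact b13 a01.symm
  have a := key5 hW hC m0 m1 m2 m3 m4 x02 x13 x41 x24 x30
  clear_value Y
  have colR : Col G (Finset.univ.filter (fun x => ¬ G.Adj h x ∨ x ∈ H)) 5 := by
    refine col_five _ _ _ _ _ ?_ (st_class hP m1 m4 x41.symm (fun hh => b41 hh.symm))
      (st_class' hP m2 m0 x02.symm (fun hh => b02 hh.symm))
      (st_class hP m3 m1 x13.symm (fun hh => b13 hh.symm))
      (st_class hP m4 m2 x24.symm (fun hh => b24 hh.symm))
      (st_class hP m0 m3 x30.symm (fun hh => b30 hh.symm))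
    intro x hx
    have b03 : ¬ G.Adj c0 c3 := fun hh => b30 hh.symm
    have b14 : ¬ G.Adj c1 c4 := fun hh => b41 hh.symm
    have b42 : ¬ G.Adj c4 c2 := fun hh => b24 hh.symm
    simp only [Finset.mem_filter, Finset.mem_univ, true_and, hH, Finset.mem_insert,
      Finset.mem_singleton] at hx
    rcases hx with hx | rfl | rfl | rfl | rfl | rfl
    · by_cases hxh : x = h
      · exact Or.inr (Or.inl (Or.inl hxh))
      · rcases a x hx hxh with k | k | k | k | k
        · exact Or.inl ⟨k.1, k.2, Or.inr (Or.inr hx)⟩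
        · exact Or.inr (Or.inl (Or.inr ⟨k.1, k.2, hx⟩))
        · exact Or.inr (Or.inr (Or.inl ⟨k.1, k.2, Or.inr (Or.inr hx)⟩))
        · exact Or.inr (Or.inr (Or.inr (Or.inl ⟨k.1, k.2, Or.inr (Or.inr hx)⟩)))
        · exact Or.inr (Or.inr (Or.inr (Or.inr ⟨k.1, k.2, Or.inr (Or.inr hx)⟩)))
    · exact Or.inr (Or.inr (Or.inr (Or.inr ⟨G.loopless.irrefl _, b30, Or.inl rfl⟩)))
    · exact Or.inl ⟨G.loopless.irrefl _, b41, Or.inl rfl⟩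
    · exact Or.inr (Or.inr (Or.inr (Or.inl ⟨b42, G.loopless.irrefl _, Or.inr (Or.inl rfl)⟩)))
    · exact Or.inr (Or.inr (Or.inr (Or.inr ⟨b03, G.loopless.irrefl _, Or.inr (Or.inl rfl)⟩)))
    · exact Or.inl ⟨b14, G.loopless.irrefl _, Or.inr (Or.inl rfl)⟩
  refine (colY.union colR).mono ?_ (by omega)
  intro x _
  simp only [Finset.mem_union, Finset.mem_filter, Finset.mem_univ, true_and, hY,
    Finset.mem_sdiff, mem_Nb]
  tauto

end c5

set_option linter.unusedSectionVars false
section c6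
variable {V : Type*} [Fintype V] {G : SimpleGraph V}

/-- an induced six-cycle in the neighbourhood of `h` -/
structure Hub (G : SimpleGraph V) (h c0 c1 c2 c3 c4 c5 : V) : Prop where
  cyc : IsC6 G c0 c1 c2 c3 c4 c5
  m0 : G.Adj h c0
  m1 : G.Adj h c1
  m2 : G.Adj h c2
  m3 : G.Adj h c3
  m4 : G.Adj h c4
  m5 : G.Adj h c5

theorem Hub.rot {h c0 c1 c2 c3 c4 c5 : V} (H : Hub G h c0 c1 c2 c3 c4 c5) :
    Hub G h c1 c2 c3 c4 c5 c0 := by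
  obtain ⟨⟨a1, a2, a3, a4, a5, a6, b1, b2, b3, b4, b5, b6, d1, d2, d3⟩, m0, m1, m2, m3, m4, m5⟩ := H
  exact ⟨⟨a2, a3, a4, a5, a6, a1, b2, b3, b4, b5, b6, b1, d2, d3, fun hh => d1 hh.symm⟩,
    m1, m2, m3, m4, m5, m0⟩

theorem ne_of_adj_of_not {a b z : V} (h1 : G.Adj a z) (h2 : ¬ G.Adj b z) : a ≠ b := by
  rintro rfl
  exact h2 h1

/-- a triangle over an edge of the cycle -/
theorem tri (hW : NoW G) {h c c' x y z : V} (hc : G.Adj h c) (hc' : G.Adj h c')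
    (hx : ¬ G.Adj h x) (hy : ¬ G.Adj h y)
    (cc : G.Adj c c') (xc : G.Adj c x) (xc' : ¬ G.Adj c' x) (yc' : G.Adj c' y) (yc : ¬ G.Adj c y)
    (zc : G.Adj c z) (zc' : G.Adj c' z) (xy : G.Adj x y) (xz : G.Adj x z) (yz : G.Adj y z) :
    False :=
  hW c c' y x z cc yc' xy.symm xc.symm
    (by rintro rfl; exact hy hc) (by rintro rfl; exact hx hc') yc xc' zc.symm zc'.symm yz.symm
    xz.symm

/-- no induced path on three vertices missing a common neighbour of `h` -/
theorem sw (hP : NoP G) {h c x y z d : V} (hc : G.Adj h c)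
    (hd : G.Adj h d) (zd : ¬ G.Adj d z)
    (hx : ¬ G.Adj h x) (hy : ¬ G.Adj h y) (hz : ¬ G.Adj h z)
    (xc : ¬ G.Adj c x) (yc : ¬ G.Adj c y) (zc : G.Adj c z) (xy : G.Adj x y) (yz : ¬ G.Adj y z) :
    G.Adj x z := by
  by_contra hn
  refine hP h c z x y hc zc xy ?_ hz hx hy xc yc (fun hh => hn hh.symm) (fun hh => yz hh.symm)
  rintro rfl
  exact zd hd.symm

theorem uq (hW : NoW G) {c c' x y z : V} (cc : ¬ G.Adj c c') (hne : c ≠ c')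
    (xc : G.Adj c x) (xc' : G.Adj c' x) (yc : G.Adj c y) (yc' : G.Adj c' y)
    (zc : G.Adj c z) (zc' : G.Adj c' z) (xy : G.Adj x y) (xz : G.Adj x z) (yz : ¬ G.Adj y z) :
    y = z := by
  by_contra hn
  exact hW c y c' z x yc yc'.symm zc' zc.symm hne hn cc yz xc.symm xy xc'.symm xz

/-- first abstract colouring: no edges between `E ∪ O` and `A ∪ B ∪ C` -/
theorem absI {s : Finset V} {E O A B C Z1 Z2 : V → Prop}
    (cov : ∀ x ∈ s, E x ∨ O x ∨ A x ∨ B x ∨ C x ∨ Z1 x ∨ Z2 x)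
    (sE : ∀ u v, E u → E v → ¬ G.Adj u v) (sO : ∀ u v, O u → O v → ¬ G.Adj u v)
    (sA : ∀ u v, A u → A v → ¬ G.Adj u v) (sB : ∀ u v, B u → B v → ¬ G.Adj u v)
    (sC : ∀ u v, C u → C v → ¬ G.Adj u v)
    (s1 : ∀ u v, Z1 u → Z1 v → ¬ G.Adj u v) (s2 : ∀ u v, Z2 u → Z2 v → ¬ G.Adj u v)
    (z1E : ∀ u v, Z1 u → E v → ¬ G.Adj u v) (z2O : ∀ u v, Z2 u → O v → ¬ G.Adj u v)
    (z1A : ∀ u v, Z1 u → A v → ¬ G.Adj u v) (z2B : ∀ u v, Z2 u → B v → ¬ G.Adj u v)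
    (nEA : ∀ u v, E u → A v → ¬ G.Adj u v) (nOB : ∀ u v, O u → B v → ¬ G.Adj u v) :
    Col G s 3 := by
  refine col_three (fun x => E x ∨ A x ∨ Z1 x) (fun x => O x ∨ B x ∨ Z2 x) C ?_ ?_ ?_ sC
  · intro v hv
    have := cov v hv
    tauto
  · rintro u v (hu | hu | hu) (hv | hv | hv) huv
    · exact sE u v hu hv huv
    · exact nEA u v hu hv huv
    · exact z1E v u hv hu huv.symm
    · exact nEA v u hv hu huv.symm
    · exact sA u v hu hv huv
    · exact z1A v u hv hu huv.symm
    · exact z1E u v hu hv huv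
    · exact z1A u v hu hv huv
    · exact s1 u v hu hv huv
  · rintro u v (hu | hu | hu) (hv | hv | hv) huv
    · exact sO u v hu hv huv
    · exact nOB u v hu hv huv
    · exact z2O v u hv hu huv.symm
    · exact nOB v u hv hu huv.symm
    · exact sB u v hu hv huv
    · exact z2B v u hv hu huv.symm
    · exact z2O u v hu hv huv
    · exact z2B u v hu hv huv
    · exact s2 u v hu hv huv

/-- second abstract colouring: `t ∈ A` has a neighbour in `F = E ∪ O`;
`S` is the union of the other two classes -/
theorem absII {s : Finset V} {E O A B C Z : V → Prop}
    (cov : ∀ x ∈ s, E x ∨ O x ∨ A x ∨ B x ∨ C x ∨ Z x)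
    (sE : ∀ u v, E u → E v → ¬ G.Adj u v) (sO : ∀ u v, O u → O v → ¬ G.Adj u v)
    (sA : ∀ u v, A u → A v → ¬ G.Adj u v) (sB : ∀ u v, B u → B v → ¬ G.Adj u v)
    (sC : ∀ u v, C u → C v → ¬ G.Adj u v) (sZ : ∀ u v, Z u → Z v → ¬ G.Adj u v)
    (zO : ∀ u v, Z u → O v → ¬ G.Adj u v)
    (uF : ∀ e a a', (E e ∨ O e) → A a → A a' → G.Adj e a → G.Adj e a' → a = a')
    (uS : ∀ b a a', (B b ∨ C b) → A a → A a' → G.Adj b a → G.Adj b a' → a = a')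
    (tEOA : ∀ e o a, E e → O o → A a → G.Adj e o → G.Adj e a → G.Adj o a → False)
    (tFAS : ∀ e a b, (E e ∨ O e) → A a → (B b ∨ C b) → G.Adj e a → G.Adj e b → G.Adj a b → False)
    (tFBC : ∀ e b c, (E e ∨ O e) → B b → C c → G.Adj e b → G.Adj e c → G.Adj b c → False)
    (tABC : ∀ a b c, A a → B b → C c → G.Adj a b → G.Adj a c → G.Adj b c → False)
    (r1 : ∀ e a b, (E e ∨ O e) → A a → (B b ∨ C b) → ¬ G.Adj a b → G.Adj e a → G.Adj e b)
    (r2 : ∀ e a b, (E e ∨ O e) → A a → (B b ∨ C b) → ¬ G.Adj a b → G.Adj e b → G.Adj e a)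
    {t n : V} (ht : A t) (hn : E n ∨ O n) (hnt : G.Adj n t) : Col G s 3 := by
  have kBC : ∀ b c, B b → C c → ¬ G.Adj t b → ¬ G.Adj t c → ¬ G.Adj b c := by
    intro b c hb hc h1 h2 h3
    exact tFBC n b c hn hb hc (r1 n t b hn ht (Or.inl hb) h1 hnt)
      (r1 n t c hn ht (Or.inr hc) h2 hnt) h3
  have kS : ∀ b c, (B b ∨ C b) → (B c ∨ C c) → ¬ G.Adj t b → ¬ G.Adj t c → ¬ G.Adj b c := by
    rintro b c (hb | hb) (hc | hc) h1 h2 h3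
    · exact sB b c hb hc h3
    · exact kBC b c hb hc h1 h2 h3
    · exact kBC c b hc hb h2 h1 h3.symm
    · exact sC b c hb hc h3
  have kS' : ∀ b c, (B b ∨ C b) → (B c ∨ C c) → G.Adj t b → G.Adj t c → ¬ G.Adj b c := by
    rintro b c (hb | hb) (hc | hc) h1 h2 h3
    · exact sB b c hb hc h3
    · exact tABC t b c ht hb hc h1 h2 h3
    · exact tABC t c b ht hc hb h2 h1 h3.symm
    · exact sC b c hb hc h3
  have kF : ∀ e f, (E e ∨ O e) → (E f ∨ O f) → G.Adj e t → G.Adj f t → ¬ G.Adj e f := by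
    rintro b c (hb | hb) (hc | hc) h1 h2 h3
    · exact sE b c hb hc h3
    · exact tEOA b c t hb hc ht h3 h1 h2
    · exact tEOA c b t hc hb ht h3.symm h2 h1
    · exact sO b c hb hc h3
  have kE1 : ∀ e b, E e → ¬ G.Adj e t → (B b ∨ C b) → ¬ G.Adj t b → ¬ G.Adj e b :=
    fun e b he het hb htb heb => het (r2 e t b (Or.inl he) ht hb htb heb)
  have kFS : ∀ e b, (E e ∨ O e) → G.Adj e t → (B b ∨ C b) → G.Adj t b → ¬ G.Adj e b :=
    fun e b he het hb htb heb => tFAS e t b he ht hb het heb htb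
  have kFA : ∀ e a, (E e ∨ O e) → G.Adj e t → A a → a ≠ t → ¬ G.Adj e a :=
    fun e a he het ha hat hea => hat (uF e a t he ha ht hea het)
  have kSA : ∀ b a, (B b ∨ C b) → G.Adj t b → A a → a ≠ t → ¬ G.Adj b a :=
    fun b a hb htb ha hat hba => hat (uS b a t hb ha ht hba htb.symm)
  refine col_three (fun x => (E x ∧ ¬ G.Adj x t) ∨ x = t ∨ ((B x ∨ C x) ∧ ¬ G.Adj t x))
    (fun x => O x ∨ Z x)
    (fun x => ((E x ∨ O x) ∧ G.Adj x t) ∨ ((B x ∨ C x) ∧ G.Adj t x) ∨ (A x ∧ x ≠ t)) ?_ ?_ ?_ ?_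
  · intro v hv
    have := cov v hv
    by_cases h1 : G.Adj v t
    · have := h1.symm
      tauto
    · have : ¬ G.Adj t v := fun hh => h1 hh.symm
      tauto
  · rintro u v (⟨hu, hu'⟩ | hu | ⟨hu, hu'⟩) (⟨hv, hv'⟩ | hv | ⟨hv, hv'⟩) huv
    · exact sE u v hu hv huv
    · subst hv; exact hu' huv
    · exact kE1 u v hu hu' hv hv' huv
    · subst hu; exact hv' huv.symm
    · subst hu; subst hv; exact huv.ne rfl
    · subst hu; exact hv' huv
    · exact kE1 v u hv hv' hu hu' huv.symm
    · subst hv; exact hu' huv.symm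
    · exact kS u v hu hv hu' hv' huv
  · rintro u v (hu | hu) (hv | hv) huv
    · exact sO u v hu hv huv
    · exact zO v u hv hu huv.symm
    · exact zO u v hu hv huv
    · exact sZ u v hu hv huv
  · rintro u v (⟨hu, hu'⟩ | ⟨hu, hu'⟩ | ⟨hu, hu'⟩) (⟨hv, hv'⟩ | ⟨hv, hv'⟩ | ⟨hv, hv'⟩) huv
    · exact kF u v hu hv hu' hv' huv
    · exact kFS u v hu hu' hv hv' huv
    · exact kFA u v hu hu' hv hv' huv
    · exact kFS v u hv hv' hu hu' huv.symm
    · exact kS' u v hu hv hu' hv' huv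
    · exact kSA u v hu hu' hv hv' huv
    · exact kFA v u hv hv' hu hu' huv.symm
    · exact kSA v u hv hv' hu hu' huv.symm
    · exact sA u v hu hv huv

end c6

set_option linter.unusedSectionVars false
set_option linter.unusedSimpArgs false
section c6b
variable {V : Type*} [Fintype V] {G : SimpleGraph V}

/-- vertices seeing exactly (0, 2, 4) on the cycle -/
def TE (G : SimpleGraph V) (h c0 c1 c2 c3 c4 c5 x : V) : Prop :=
  ¬ G.Adj h x ∧ G.Adj c0 x ∧ ¬ G.Adj c1 x ∧ G.Adj c2 x ∧ ¬ G.Adj c3 x ∧ G.Adj c4 x ∧ ¬ G.Adj c5 x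

/-- vertices seeing exactly (1, 3, 5) on the cycle -/
def TO (G : SimpleGraph V) (h c0 c1 c2 c3 c4 c5 x : V) : Prop :=
  ¬ G.Adj h x ∧ ¬ G.Adj c0 x ∧ G.Adj c1 x ∧ ¬ G.Adj c2 x ∧ G.Adj c3 x ∧ ¬ G.Adj c4 x ∧ G.Adj c5 x

/-- vertices seeing exactly (0, 1, 3, 4) on the cycle -/
def TA (G : SimpleGraph V) (h c0 c1 c2 c3 c4 c5 x : V) : Prop :=
  ¬ G.Adj h x ∧ G.Adj c0 x ∧ G.Adj c1 x ∧ ¬ G.Adj c2 x ∧ G.Adj c3 x ∧ G.Adj c4 x ∧ ¬ G.Adj c5 x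

/-- vertices seeing exactly (0, 2, 3, 5) on the cycle -/
def TB (G : SimpleGraph V) (h c0 c1 c2 c3 c4 c5 x : V) : Prop :=
  ¬ G.Adj h x ∧ G.Adj c0 x ∧ ¬ G.Adj c1 x ∧ G.Adj c2 x ∧ G.Adj c3 x ∧ ¬ G.Adj c4 x ∧ G.Adj c5 x

/-- vertices seeing exactly (1, 2, 4, 5) on the cycle -/
def TC (G : SimpleGraph V) (h c0 c1 c2 c3 c4 c5 x : V) : Prop :=
  ¬ G.Adj h x ∧ ¬ G.Adj c0 x ∧ G.Adj c1 x ∧ G.Adj c2 x ∧ ¬ G.Adj c3 x ∧ G.Adj c4 x ∧ G.Adj c5 x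

/-- the remaining vertices outside the neighbourhood of `h` -/
def TZ (G : SimpleGraph V) (h c0 c1 c2 c3 c4 c5 x : V) : Prop :=
  x = h ∨ (¬ G.Adj h x ∧
    ((¬ G.Adj c0 x ∧ ¬ G.Adj c3 x ∧ ¬ G.Adj c1 x ∧ ¬ G.Adj c4 x) ∨
     (¬ G.Adj c0 x ∧ ¬ G.Adj c3 x ∧ ¬ G.Adj c2 x ∧ ¬ G.Adj c5 x) ∨
     (¬ G.Adj c1 x ∧ ¬ G.Adj c4 x ∧ ¬ G.Adj c2 x ∧ ¬ G.Adj c5 x)))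

/-- two non-neighbours of `h` missing two nonadjacent vertices of the cycle -/
theorem st2 (hP : NoP G) {h a b : V} (ha : G.Adj h a) (hb : G.Adj h b) (hab : a ≠ b)
    (hnab : ¬ G.Adj a b) {u v : V} (hu : ¬ G.Adj h u) (hv : ¬ G.Adj h v)
    (u1 : ¬ G.Adj a u) (v1 : ¬ G.Adj a v) (u2 : ¬ G.Adj b u) (v2 : ¬ G.Adj b v) :
    ¬ G.Adj u v :=
  fun huv => hP a h b u v ha.symm hb huv hab hnab u1 v1 hu hv u2 v2

theorem Hub.nn02 {h c0 c1 c2 c3 c4 c5 : V} (H : Hub G h c0 c1 c2 c3 c4 c5) :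
    c0 ≠ c2 ∧ ¬ G.Adj c0 c2 := by
  obtain ⟨⟨a1, a2, a3, a4, a5, a6, b1, b2, b3, b4, b5, b6, d1, d2, d3⟩, m0, m1, m2, m3, m4, m5⟩ := H
  exact ⟨by rintro rfl; exact d1 a3, b1⟩

theorem Hub.nn03 {h c0 c1 c2 c3 c4 c5 : V} (H : Hub G h c0 c1 c2 c3 c4 c5) :
    c0 ≠ c3 ∧ ¬ G.Adj c0 c3 := by
  obtain ⟨⟨a1, a2, a3, a4, a5, a6, b1, b2, b3, b4, b5, b6, d1, d2, d3⟩, m0, m1, m2, m3, m4, m5⟩ := H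
  exact ⟨by rintro rfl; exact b1 a3.symm, d1⟩

theorem Hub.sE (hP : NoP G) {h c0 c1 c2 c3 c4 c5 : V} (H : Hub G h c0 c1 c2 c3 c4 c5)
    (u v : V) (hu : TE G h c0 c1 c2 c3 c4 c5 u) (hv : TE G h c0 c1 c2 c3 c4 c5 v) : ¬ G.Adj u v :=
  st2 hP H.m1 H.m3 H.rot.nn02.1 H.rot.nn02.2 hu.1 hv.1 hu.2.2.1 hv.2.2.1 hu.2.2.2.2.1 hv.2.2.2.2.1

theorem Hub.sO (hP : NoP G) {h c0 c1 c2 c3 c4 c5 : V} (H : Hub G h c0 c1 c2 c3 c4 c5)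
    (u v : V) (hu : TO G h c0 c1 c2 c3 c4 c5 u) (hv : TO G h c0 c1 c2 c3 c4 c5 v) : ¬ G.Adj u v :=
  st2 hP H.m0 H.m2 H.nn02.1 H.nn02.2 hu.1 hv.1 hu.2.1 hv.2.1 hu.2.2.2.1 hv.2.2.2.1

theorem Hub.sA (hP : NoP G) {h c0 c1 c2 c3 c4 c5 : V} (H : Hub G h c0 c1 c2 c3 c4 c5)
    (u v : V) (hu : TA G h c0 c1 c2 c3 c4 c5 u) (hv : TA G h c0 c1 c2 c3 c4 c5 v) : ¬ G.Adj u v :=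
  st2 hP H.m2 H.m5 H.rot.rot.nn03.1 H.rot.rot.nn03.2 hu.1 hv.1 hu.2.2.2.1 hv.2.2.2.1 hu.2.2.2.2.2.2 hv.2.2.2.2.2.2

theorem Hub.sB (hP : NoP G) {h c0 c1 c2 c3 c4 c5 : V} (H : Hub G h c0 c1 c2 c3 c4 c5)
    (u v : V) (hu : TB G h c0 c1 c2 c3 c4 c5 u) (hv : TB G h c0 c1 c2 c3 c4 c5 v) : ¬ G.Adj u v :=
  st2 hP H.m1 H.m4 H.rot.nn03.1 H.rot.nn03.2 hu.1 hv.1 hu.2.2.1 hv.2.2.1 hu.2.2.2.2.2.1 hv.2.2.2.2.2.1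

theorem Hub.sC (hP : NoP G) {h c0 c1 c2 c3 c4 c5 : V} (H : Hub G h c0 c1 c2 c3 c4 c5)
    (u v : V) (hu : TC G h c0 c1 c2 c3 c4 c5 u) (hv : TC G h c0 c1 c2 c3 c4 c5 v) : ¬ G.Adj u v :=
  st2 hP H.m0 H.m3 H.nn03.1 H.nn03.2 hu.1 hv.1 hu.2.1 hv.2.1 hu.2.2.2.2.1 hv.2.2.2.2.1

theorem Hub.sZ (hP : NoP G) {h c0 c1 c2 c3 c4 c5 : V} (H : Hub G h c0 c1 c2 c3 c4 c5)
    (u v : V) (hu : TZ G h c0 c1 c2 c3 c4 c5 u) (hv : TZ G h c0 c1 c2 c3 c4 c5 v) : ¬ G.Adj u v := by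
  rcases hu with rfl | ⟨hu, hu'⟩
  · rcases hv with rfl | ⟨hv, hv'⟩
    · exact G.loopless.irrefl _
    · exact hv
  rcases hv with rfl | ⟨hv, hv'⟩
  · exact fun hh => hu hh.symm
  rcases hu' with ku | ku | ku <;> rcases hv' with kv | kv | kv
  · exact st2 hP H.m0 H.m3 H.nn03.1 H.nn03.2 hu hv ku.1 kv.1 ku.2.1 kv.2.1
  · exact st2 hP H.m0 H.m3 H.nn03.1 H.nn03.2 hu hv ku.1 kv.1 ku.2.1 kv.2.1
  · exact st2 hP H.m1 H.m4 H.rot.nn03.1 H.rot.nn03.2 hu hv ku.2.2.1 kv.1 ku.2.2.2 kv.2.1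
  · exact st2 hP H.m0 H.m3 H.nn03.1 H.nn03.2 hu hv ku.1 kv.1 ku.2.1 kv.2.1
  · exact st2 hP H.m0 H.m2 H.nn02.1 H.nn02.2 hu hv ku.1 kv.1 ku.2.2.1 kv.2.2.1
  · exact st2 hP H.m2 H.m5 H.rot.rot.nn03.1 H.rot.rot.nn03.2 hu hv ku.2.2.1 kv.2.2.1 ku.2.2.2 kv.2.2.2
  · exact st2 hP H.m1 H.m4 H.rot.nn03.1 H.rot.nn03.2 hu hv ku.1 kv.2.2.1 ku.2.1 kv.2.2.2
  · exact st2 hP H.m2 H.m5 H.rot.rot.nn03.1 H.rot.rot.nn03.2 hu hv ku.2.2.1 kv.2.2.1 ku.2.2.2 kv.2.2.2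
  · exact st2 hP H.m1 H.m4 H.rot.nn03.1 H.rot.nn03.2 hu hv ku.1 kv.1 ku.2.1 kv.2.1

theorem Hub.zE (hP : NoP G) {h c0 c1 c2 c3 c4 c5 : V} (H : Hub G h c0 c1 c2 c3 c4 c5)
    (u v : V) (hu : TZ G h c0 c1 c2 c3 c4 c5 u) (hv : TE G h c0 c1 c2 c3 c4 c5 v) : ¬ G.Adj u v := by
  rcases hu with rfl | ⟨hu, ku | ku | ku⟩
  · exact hv.1
  · exact st2 hP H.m1 H.m3 H.rot.nn02.1 H.rot.nn02.2 hu hv.1 ku.2.2.1 hv.2.2.1 ku.2.1 hv.2.2.2.2.1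
  · exact st2 hP H.m3 H.m5 H.rot.rot.rot.nn02.1 H.rot.rot.rot.nn02.2 hu hv.1 ku.2.1 hv.2.2.2.2.1 ku.2.2.2 hv.2.2.2.2.2.2
  · exact st2 hP H.m1 H.m5 H.rot.rot.rot.rot.rot.nn02.1.symm (fun hh => H.rot.rot.rot.rot.rot.nn02.2 hh.symm) hu hv.1 ku.1 hv.2.2.1 ku.2.2.2 hv.2.2.2.2.2.2

theorem Hub.zO (hP : NoP G) {h c0 c1 c2 c3 c4 c5 : V} (H : Hub G h c0 c1 c2 c3 c4 c5)
    (u v : V) (hu : TZ G h c0 c1 c2 c3 c4 c5 u) (hv : TO G h c0 c1 c2 c3 c4 c5 v) : ¬ G.Adj u v := by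
  rcases hu with rfl | ⟨hu, ku | ku | ku⟩
  · exact hv.1
  · exact st2 hP H.m0 H.m4 H.rot.rot.rot.rot.nn02.1.symm (fun hh => H.rot.rot.rot.rot.nn02.2 hh.symm) hu hv.1 ku.1 hv.2.1 ku.2.2.2 hv.2.2.2.2.2.1
  · exact st2 hP H.m0 H.m2 H.nn02.1 H.nn02.2 hu hv.1 ku.1 hv.2.1 ku.2.2.1 hv.2.2.2.1
  · exact st2 hP H.m2 H.m4 H.rot.rot.nn02.1 H.rot.rot.nn02.2 hu hv.1 ku.2.2.1 hv.2.2.2.1 ku.2.1 hv.2.2.2.2.2.1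

theorem Hub.rule (hP : NoP G) (hW : NoW G) {h c0 c1 c2 c3 c4 c5 : V} (H : Hub G h c0 c1 c2 c3 c4 c5)
    {x : V} (hxh : x ≠ h) (hx : ¬ G.Adj h x) :
    ¬ (G.Adj c0 x ∧ G.Adj c1 x ∧ G.Adj c2 x) ∧
    ¬ (G.Adj c2 x ∧ ¬ G.Adj c1 x ∧ ¬ G.Adj c4 x ∧ ¬ G.Adj c5 x) ∧
    ¬ (G.Adj c1 x ∧ ¬ G.Adj c2 x ∧ ¬ G.Adj c4 x ∧ ¬ G.Adj c5 x) ∧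
    ¬ (G.Adj c0 x ∧ ¬ G.Adj c2 x ∧ ¬ G.Adj c3 x ∧ ¬ G.Adj c4 x) := by
  have n02 := H.nn02.1
  have n24 := H.rot.rot.nn02.1
  obtain ⟨⟨a1, a2, a3, a4, a5, a6, b1, b2, b3, b4, b5, b6, d1, d2, d3⟩, m0, m1, m2, m3, m4, m5⟩ := H
  refine ⟨?_, ?_, ?_, ?_⟩
  · rintro ⟨h1, h2, h3⟩
    exact hW c0 h c2 x c1 m0.symm m2 h3 h1.symm n02 hxh.symm b1 hx a1.symm m1.symm a2 h2
  · rintro ⟨h1, h2, h3, h4⟩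
    exact hP c1 c2 x c4 c5 a2 h1 a5 (by rintro rfl; exact hx m1) h2 d2
      (fun hh => b6 hh.symm) b3 d3 (fun hh => h3 hh.symm) (fun hh => h4 hh.symm)
  · rintro ⟨h1, h2, h3, h4⟩
    exact hP c2 c1 x c4 c5 a2.symm h1 a5 (by rintro rfl; exact hx m2) h2 b3 d3 d2
      (fun hh => b6 hh.symm) (fun hh => h3 hh.symm) (fun hh => h4 hh.symm)
  · rintro ⟨h1, h2, h3, h4⟩
    exact hP c2 c3 c4 x c0 a3 a4 h1.symm n24 b3 h2 (fun hh => b1 hh.symm) h3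
      (fun hh => d1 hh.symm) h4 b5

theorem Hub.cover (hP : NoP G) (hW : NoW G) {h c0 c1 c2 c3 c4 c5 : V} (H : Hub G h c0 c1 c2 c3 c4 c5)
    (x : V) (hx : ¬ G.Adj h x) :
    TE G h c0 c1 c2 c3 c4 c5 x ∨ TO G h c0 c1 c2 c3 c4 c5 x ∨ TA G h c0 c1 c2 c3 c4 c5 x ∨ TB G h c0 c1 c2 c3 c4 c5 x ∨ TC G h c0 c1 c2 c3 c4 c5 x ∨
      TZ G h c0 c1 c2 c3 c4 c5 x := by
  by_cases hxh : x = h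
  · exact Or.inr (Or.inr (Or.inr (Or.inr (Or.inr (Or.inl hxh)))))
  have R := fun d0 d1 d2 d3 d4 d5 (K : Hub G h d0 d1 d2 d3 d4 d5) => K.rule hP hW hxh hx
  obtain ⟨r0, r1, r2, r3⟩ := R _ _ _ _ _ _ H
  obtain ⟨r4, r5, r6, r7⟩ := R _ _ _ _ _ _ H.rot
  obtain ⟨r8, r9, r10, r11⟩ := R _ _ _ _ _ _ H.rot.rot
  obtain ⟨r12, r13, r14, r15⟩ := R _ _ _ _ _ _ H.rot.rot.rot
  obtain ⟨r16, r17, r18, r19⟩ := R _ _ _ _ _ _ H.rot.rot.rot.rot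
  obtain ⟨r20, r21, r22, r23⟩ := R _ _ _ _ _ _ H.rot.rot.rot.rot.rot
  clear R H hW hP
  unfold TE TO TA TB TC TZ
  by_cases p0 : G.Adj c0 x <;> by_cases p1 : G.Adj c1 x <;> by_cases p2 : G.Adj c2 x <;>
    by_cases p3 : G.Adj c3 x <;> by_cases p4 : G.Adj c4 x <;> by_cases p5 : G.Adj c5 x <;>
    simp only [p0, p1, p2, p3, p4, p5, hx, hxh, not_true_eq_false, not_false_eq_true, and_true,
      true_and, and_false, false_and, or_true, true_or, or_false, false_or] at *

set_option maxHeartbeats 1000000 in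
theorem Hub.caseII (hP : NoP G) (hW : NoW G) {h c0 c1 c2 c3 c4 c5 : V} (H : Hub G h c0 c1 c2 c3 c4 c5)
    {s : Finset V} (hs : ∀ x ∈ s, ¬ G.Adj h x) {t n : V} (ht : TA G h c0 c1 c2 c3 c4 c5 t)
    (hn : TE G h c0 c1 c2 c3 c4 c5 n ∨ TO G h c0 c1 c2 c3 c4 c5 n) (hnt : G.Adj n t) : Col G s 3 := by
  refine absII (fun x hx => H.cover hP hW x (hs x hx)) (H.sE hP) (H.sO hP) (H.sA hP) (H.sB hP)
    (H.sC hP) (H.sZ hP) (H.zO hP) ?_ ?_ ?_ ?_ ?_ ?_ ?_ ?_ ht hn hnt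
  · rintro e a a2 (he | he) ha ha2 h1 h2
    · exact uq hW (fun hh => H.rot.rot.rot.rot.nn02.2 hh.symm) H.rot.rot.rot.rot.nn02.1.symm he.2.1 he.2.2.2.2.2.1 ha.2.1 ha.2.2.2.2.2.1 ha2.2.1 ha2.2.2.2.2.2.1 h1 h2
        (H.sA hP _ _ ha ha2)
    · exact uq hW H.rot.nn02.2 H.rot.nn02.1 he.2.2.1 he.2.2.2.2.1 ha.2.2.1 ha.2.2.2.2.1 ha2.2.2.1 ha2.2.2.2.2.1 h1 h2
        (H.sA hP _ _ ha ha2)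
  · rintro e a a2 (he | he) ha ha2 h1 h2
    · exact uq hW H.nn03.2 H.nn03.1 he.2.1 he.2.2.2.2.1 ha.2.1 ha.2.2.2.2.1 ha2.2.1 ha2.2.2.2.2.1 h1 h2
        (H.sA hP _ _ ha ha2)
    · exact uq hW H.rot.nn03.2 H.rot.nn03.1 he.2.2.1 he.2.2.2.2.2.1 ha.2.2.1 ha.2.2.2.2.2.1 ha2.2.2.1 ha2.2.2.2.2.2.1 h1 h2
        (H.sA hP _ _ ha ha2)
  · intro e o a he ho ha h1 h2 h3
    exact tri hW H.m0 H.m1 he.1 ho.1 H.cyc.1 he.2.1 he.2.2.1 ho.2.2.1 ho.2.1 ha.2.1 ha.2.2.1 h1 h2 h3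
  · rintro e a b (he | he) ha (hb | hb) h1 h2 h3
    · exact tri hW H.m2 H.m3 he.1 ha.1 H.rot.rot.cyc.1 he.2.2.2.1 he.2.2.2.2.1 ha.2.2.2.2.1 ha.2.2.2.1 hb.2.2.2.1 hb.2.2.2.2.1 h1 h2 h3
    · exact tri hW H.m0 H.m1 he.1 hb.1 H.cyc.1 he.2.1 he.2.2.1 hb.2.2.1 hb.2.1 ha.2.1 ha.2.2.1 h2 h1 h3.symm
    · exact tri hW H.m1 H.m0 he.1 hb.1 (H.cyc.1).symm he.2.2.1 he.2.1 hb.2.1 hb.2.2.1 ha.2.2.1 ha.2.1 h2 h1 h3.symm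
    · exact tri hW H.m3 H.m4 he.1 hb.1 H.rot.rot.rot.cyc.1 he.2.2.2.2.1 he.2.2.2.2.2.1 hb.2.2.2.2.2.1 hb.2.2.2.2.1 ha.2.2.2.2.1 ha.2.2.2.2.2.1 h2 h1 h3.symm
  · rintro e b c (he | he) hb hc h1 h2 h3
    · exact tri hW H.m0 H.m5 he.1 hc.1 (H.rot.rot.rot.rot.rot.cyc.1).symm he.2.1 he.2.2.2.2.2.2 hc.2.2.2.2.2.2 hc.2.1 hb.2.1 hb.2.2.2.2.2.2 h2 h1 h3.symm
    · exact tri hW H.m1 H.m2 he.1 hb.1 H.rot.cyc.1 he.2.2.1 he.2.2.2.1 hb.2.2.2.1 hb.2.2.1 hc.2.2.1 hc.2.2.2.1 h1 h2 h3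
  · intro a b c ha hb hc h1 h2 h3
    exact tri hW H.m0 H.m1 hb.1 hc.1 H.cyc.1 hb.2.1 hb.2.2.1 hc.2.2.1 hc.2.1 ha.2.1 ha.2.2.1 h3 h1.symm h2.symm
  · rintro e a b (he | he) ha (hb | hb) h1 h2
    · exact sw hP H.m5 H.m1 hb.2.2.1 he.1 ha.1 hb.1 he.2.2.2.2.2.2 ha.2.2.2.2.2.2 hb.2.2.2.2.2.2 h2 h1
    · exact sw hP H.m5 H.m0 hb.2.1 he.1 ha.1 hb.1 he.2.2.2.2.2.2 ha.2.2.2.2.2.2 hb.2.2.2.2.2.2 h2 h1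
    · exact sw hP H.m2 H.m1 hb.2.2.1 he.1 ha.1 hb.1 he.2.2.2.1 ha.2.2.2.1 hb.2.2.2.1 h2 h1
    · exact sw hP H.m2 H.m0 hb.2.1 he.1 ha.1 hb.1 he.2.2.2.1 ha.2.2.2.1 hb.2.2.2.1 h2 h1
  · rintro e a b (he | he) ha (hb | hb) h1 h2
    · exact sw hP H.m1 H.m2 ha.2.2.2.1 he.1 hb.1 ha.1 he.2.2.1 hb.2.2.1 ha.2.2.1 h2 (fun hh => h1 hh.symm)
    · exact sw hP H.m3 H.m2 ha.2.2.2.1 he.1 hb.1 ha.1 he.2.2.2.2.1 hb.2.2.2.2.1 ha.2.2.2.2.1 h2 (fun hh => h1 hh.symm)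
    · exact sw hP H.m4 H.m2 ha.2.2.2.1 he.1 hb.1 ha.1 he.2.2.2.2.2.1 hb.2.2.2.2.2.1 ha.2.2.2.2.2.1 h2 (fun hh => h1 hh.symm)
    · exact sw hP H.m0 H.m2 ha.2.2.2.1 he.1 hb.1 ha.1 he.2.1 hb.2.1 ha.2.1 h2 (fun hh => h1 hh.symm)

theorem Hub.caseI (hP : NoP G) (hW : NoW G) {h c0 c1 c2 c3 c4 c5 : V} (H : Hub G h c0 c1 c2 c3 c4 c5)
    {s : Finset V} (hs : ∀ x ∈ s, ¬ G.Adj h x)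
    (nEA : ∀ u v, TE G h c0 c1 c2 c3 c4 c5 u → TA G h c0 c1 c2 c3 c4 c5 v → ¬ G.Adj u v)
    (nOB : ∀ u v, TO G h c0 c1 c2 c3 c4 c5 u → TB G h c0 c1 c2 c3 c4 c5 v → ¬ G.Adj u v) : Col G s 3 := by
  refine absI (Z1 := (fun x => TZ G h c0 c1 c2 c3 c4 c5 x ∧ x ≠ h ∧ ¬ G.Adj h x ∧ ¬ G.Adj c2 x ∧ ¬ G.Adj c5 x))
    (Z2 := (fun x => TZ G h c0 c1 c2 c3 c4 c5 x ∧ (x = h ∨ ¬ G.Adj h x ∧ ¬ G.Adj c1 x ∧ ¬ G.Adj c4 x)))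
    ?_ (H.sE hP) (H.sO hP) (H.sA hP) (H.sB hP) (H.sC hP) (fun u v hu hv => H.sZ hP u v hu.1 hv.1)
    (fun u v hu hv => H.sZ hP u v hu.1 hv.1) (fun u v hu hv => H.zE hP u v hu.1 hv)
    (fun u v hu hv => H.zO hP u v hu.1 hv) ?_ ?_ nEA nOB
  · intro x hx
    rcases H.cover hP hW x (hs x hx) with k | k | k | k | k | k
    · exact Or.inl k
    · exact Or.inr (Or.inl k)
    · exact Or.inr (Or.inr (Or.inl k))
    · exact Or.inr (Or.inr (Or.inr (Or.inl k)))
    · exact Or.inr (Or.inr (Or.inr (Or.inr (Or.inl k))))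
    · refine Or.inr (Or.inr (Or.inr (Or.inr (Or.inr ?_))))
      by_cases hxh : x = h
      · exact Or.inr ⟨k, Or.inl hxh⟩
      · rcases id k with e | ⟨e, k' | k' | k'⟩
        · exact (hxh e).elim
        · exact Or.inr ⟨k, Or.inr ⟨e, k'.2.2⟩⟩
        · exact Or.inl ⟨k, hxh, e, k'.2.2⟩
        · exact Or.inl ⟨k, hxh, e, k'.2.2⟩
  · rintro u v ⟨-, -, hu, u1, u2⟩ hv
    exact st2 hP H.m2 H.m5 H.rot.rot.nn03.1 H.rot.rot.nn03.2 hu hv.1 u1 hv.2.2.2.1 u2 hv.2.2.2.2.2.2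
  · rintro u v ⟨-, rfl | ⟨hu, u1, u2⟩⟩ hv
    · exact hv.1
    · exact st2 hP H.m1 H.m4 H.rot.nn03.1 H.rot.nn03.2 hu hv.1 u1 hv.2.2.1 u2 hv.2.2.2.2.2.1

theorem Hub.colX (hP : NoP G) (hW : NoW G) {h c0 c1 c2 c3 c4 c5 : V} (H : Hub G h c0 c1 c2 c3 c4 c5)
    {s : Finset V} (hs : ∀ x ∈ s, ¬ G.Adj h x) : Col G s 3 := by
  by_cases e1 : ∃ u v, TE G h c0 c1 c2 c3 c4 c5 u ∧ TA G h c0 c1 c2 c3 c4 c5 v ∧ G.Adj u v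
  · obtain ⟨u, v, hu, hv, huv⟩ := e1
    exact H.caseII hP hW hs hv (Or.inl hu) huv
  by_cases e2 : ∃ u v, TO G h c0 c1 c2 c3 c4 c5 u ∧ TB G h c0 c1 c2 c3 c4 c5 v ∧ G.Adj u v
  · obtain ⟨u, v, hu, hv, huv⟩ := e2
    refine H.rot.rot.caseII hP hW hs (t := v) (n := u) ?_ (Or.inr ?_) huv
    · obtain ⟨k, k0, k1, k2, k3, k4, k5⟩ := hv
      exact ⟨k, k2, k3, k4, k5, k0, k1⟩
    · obtain ⟨k, k0, k1, k2, k3, k4, k5⟩ := hu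
      exact ⟨k, k2, k3, k4, k5, k0, k1⟩
  push Not at e1 e2
  exact H.caseI hP hW hs e1 e2

theorem case_c6 (hP : NoP G) (hW : NoW G) {h c0 c1 c2 c3 c4 c5 : V} (H : Hub G h c0 c1 c2 c3 c4 c5)
    {w : ℕ} (hw : CB G Finset.univ w) : Col G Finset.univ (2 * w) := by
  classical
  have hw3 : 3 ≤ w := by
    have := card_insert_clique hw {c0, c1} (by simp [H.cyc.1]) h (by simp [H.m0, H.m1])
    rwa [Finset.card_pair H.cyc.1.ne] at this
  have hM : CB G (Nb G h) (w - 1) := by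
    intro Q' hQ' hc
    have := card_insert_clique hw Q' hc h (fun x hx => mem_Nb.1 (hQ' hx))
    omega
  have colN : Col G (Nb G h) (2 * (w - 1) - 1) :=
    col_c4free hP (noC4_Nb hW h) (by omega) hM
  have colX : Col G (Finset.univ.filter (fun x => ¬ G.Adj h x)) 3 :=
    H.colX hP hW (fun x hx => (Finset.mem_filter.1 hx).2)
  refine (colN.union colX).mono ?_ (by omega)
  intro x _
  simp only [Finset.mem_union, Finset.mem_filter, Finset.mem_univ, true_and, mem_Nb]
  tauto

end c6b

theorem noP_of_isEmpty {V : Type*} {G : SimpleGraph V} (hP : IsEmpty (P3P2 ↪g G)) : NoP G := by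
  intro a b c d e ab bc de hac nac nad nae nbd nbe ncd nce
  have ad : a ≠ d := by rintro rfl; exact nbd ab.symm
  have ae : a ≠ e := by rintro rfl; exact nbe ab.symm
  have bd : b ≠ d := by rintro rfl; exact nad ab
  have be : b ≠ e := by rintro rfl; exact nae ab
  have cd : c ≠ d := by rintro rfl; exact nbd bc
  have ce : c ≠ e := by rintro rfl; exact nbe bc
  have nca : ¬ G.Adj c a := fun hh => nac hh.symm
  have nda : ¬ G.Adj d a := fun hh => nad hh.symm
  have nea : ¬ G.Adj e a := fun hh => nae hh.symm
  have ndb : ¬ G.Adj d b := fun hh => nbd hh.symm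
  have neb : ¬ G.Adj e b := fun hh => nbe hh.symm
  have ndc : ¬ G.Adj d c := fun hh => ncd hh.symm
  have nec : ¬ G.Adj e c := fun hh => nce hh.symm
  refine hP.false ⟨⟨![a, b, c, d, e], ?_⟩, ?_⟩
  · intro i j hij
    fin_cases i <;> fin_cases j <;>
      simp [ab.ne, ab.ne.symm, bc.ne, bc.ne.symm, de.ne, de.ne.symm, hac, hac.symm, ad, ad.symm,
        ae, ae.symm, bd, bd.symm, be, be.symm, cd, cd.symm, ce, ce.symm] at hij ⊢
  · intro i j
    change G.Adj (![a, b, c, d, e] i) (![a, b, c, d, e] j) ↔ _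
    fin_cases i <;> fin_cases j <;>
      simp [P3P2, ab, ab.symm, bc, bc.symm, de, de.symm, nac, nad, nae, nbd, nbe, ncd, nce,
        nca, nda, nea, ndb, neb, ndc, nec]

theorem noW_of_isEmpty {V : Type*} {G : SimpleGraph V} (hW : IsEmpty (W4 ↪g G)) : NoW G := by
  intro a b c d h ab bc cd da hac hbd nac nbd ha hb hc hd
  have nca : ¬ G.Adj c a := fun hh => nac hh.symm
  have ndb : ¬ G.Adj d b := fun hh => nbd hh.symm
  refine hW.false ⟨⟨![a, b, c, d, h], ?_⟩, ?_⟩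
  · intro i j hij
    fin_cases i <;> fin_cases j <;>
      simp [ab.ne, ab.ne.symm, bc.ne, bc.ne.symm, cd.ne, cd.ne.symm, da.ne, da.ne.symm,
        hac, hac.symm, hbd, hbd.symm, ha.ne, ha.ne.symm, hb.ne, hb.ne.symm, hc.ne, hc.ne.symm,
        hd.ne, hd.ne.symm] at hij ⊢
  · intro i j
    change G.Adj (![a, b, c, d, h] i) (![a, b, c, d, h] j) ↔ _
    fin_cases i <;> fin_cases j <;>
      simp [W4, ab, ab.symm, bc, bc.symm, cd, cd.symm, da, da.symm, nac, nbd, nca, ndb,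
        ha, ha.symm, hb, hb.symm, hc, hc.symm, hd, hd.symm]

theorem col_main {V : Type*} [Fintype V] {G : SimpleGraph V} (hP : NoP G) (hW : NoW G)
    {w : ℕ} (hw : CB G Finset.univ w) : Col G Finset.univ (2 * w) := by
  by_cases h6 : ∀ v, NoC6 G (Nb G v)
  swap
  · simp only [NoC6] at h6
    push Not at h6
    obtain ⟨h, a, ma, b, mb, c, mc, d, md, e, me, f, mf, hC⟩ := h6
    rw [mem_Nb] at ma mb mc md me mf
    exact case_c6 hP hW ⟨hC, ma, mb, mc, md, me, mf⟩ hw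
  by_cases h5 : ∀ v, NoC5 G (Nb G v)
  swap
  · simp only [NoC5] at h5
    push Not at h5
    obtain ⟨h, a, ma, b, mb, c, mc, d, md, e, me, hC⟩ := h5
    rw [mem_Nb] at ma mb mc md me
    exact case_c5 hP hW h (h6 h) hC ma mb mc md me hw
  by_cases hE : ∃ u v, G.Adj u v
  · obtain ⟨u, v, huv⟩ := hE
    exact case_chordal hP hW h5 h6 hw huv
  · push Not at hE
    refine ⟨fun _ => 0, ?_, fun u _ v _ huv => (hE u v huv).elim⟩
    intro v _
    have := hw {v} (Finset.subset_univ _) (by simp)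
    simp at this
    dsimp only
    omega

theorem stmt0 {V : Type*} [Fintype V] (G : SimpleGraph V)
    (hP : IsEmpty (P3P2 ↪g G)) (hW : IsEmpty (W4 ↪g G)) :
    G.chromaticNumber ≤ (2 * G.cliqueNum : ℕ∞) := by
  have hw : CB G Finset.univ G.cliqueNum := fun Q _ hQ => hQ.card_le_cliqueNum
  obtain ⟨f, h1, h2⟩ := col_main (noP_of_isEmpty hP) (noW_of_isEmpty hW) hw
  have hc : G.Colorable (2 * G.cliqueNum) :=
    ⟨Coloring.mk (fun v => (⟨f v, h1 v (Finset.mem_univ v)⟩ : Fin (2 * G.cliqueNum))) (by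
      intro u v huv hh
      exact h2 u (Finset.mem_univ u) v (Finset.mem_univ v) huv (Fin.mk.inj_iff.1 hh))⟩
  have := hc.chromaticNumber_le
  simpa using this
end

section
/- Let G be a finite simple graph. If G is both (P3∪P2)-free and W4-free and ω(G) ≥ 5, then χ(G) ≤ 2·ω(G). -/
open SimpleGraph

namespace Aux

/-- The working context: `A` is a maximum clique with at least five vertices, and the two
forbidden subgraphs are excluded (in elementwise form). -/
structure Ctx {V : Type*} (G : SimpleGraph V) (A : Finset V) : Prop where
  clq : ∀ x ∈ A, ∀ y ∈ A, x ≠ y → G.Adj x y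
  max : ∀ Q : Finset V, (∀ x ∈ Q, ∀ y ∈ Q, x ≠ y → G.Adj x y) → Q.card ≤ A.card
  five : 5 ≤ A.card
  p3 : ∀ x y z u v, G.Adj x y → G.Adj y z → x ≠ z → ¬ G.Adj x z → G.Adj u v →
    ¬ G.Adj x u → ¬ G.Adj x v → ¬ G.Adj y u → ¬ G.Adj y v → ¬ G.Adj z u → ¬ G.Adj z v → False
  w4 : ∀ p q r s h, G.Adj p q → G.Adj q r → G.Adj r s → G.Adj s p → p ≠ r → ¬ G.Adj p r →
    q ≠ s → ¬ G.Adj q s → G.Adj h p → G.Adj h q → G.Adj h r → G.Adj h s → False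

/-- `K` is a largest clique outside `A` having two common non-neighbours in `A`; `a`, `b` are
such non-neighbours. -/
structure KCtx {V : Type*} (G : SimpleGraph V) (A K : Finset V) (a b : V) : Prop
    extends Ctx G A where
  ha : a ∈ A
  hb : b ∈ A
  hab : a ≠ b
  Kclq : ∀ x ∈ K, ∀ y ∈ K, x ≠ y → G.Adj x y
  Kdis : ∀ z ∈ K, z ∉ A
  Ka : ∀ z ∈ K, ¬ G.Adj z a
  Kb : ∀ z ∈ K, ¬ G.Adj z b
  Kmax : ∀ Q : Finset V, (∀ x ∈ Q, ∀ y ∈ Q, x ≠ y → G.Adj x y) → (∀ z ∈ Q, z ∉ A) →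
    ∀ i ∈ A, ∀ j ∈ A, i ≠ j → (∀ z ∈ Q, ¬ G.Adj z i ∧ ¬ G.Adj z j) → Q.card ≤ K.card

variable {V : Type*} {G : SimpleGraph V} {A K : Finset V} {a b : V}

theorem KCtx.symm (h : KCtx G A K a b) : KCtx G A K b a :=
  { toCtx := h.toCtx, ha := h.hb, hb := h.ha, hab := h.hab.symm, Kclq := h.Kclq, Kdis := h.Kdis,
    Ka := h.Kb, Kb := h.Ka, Kmax := h.Kmax }

open Classical in
/-- Neighbours of `x` inside `A`. -/
noncomputable def nb (G : SimpleGraph V) (A : Finset V) (x : V) : Finset V :=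
  A.filter (fun v => G.Adj x v)

theorem mem_nb {x v : V} : v ∈ nb G A x ↔ v ∈ A ∧ G.Adj x v := by
  simp [nb]

theorem nb_sub (x : V) : nb G A x ⊆ A := fun _ h => (mem_nb.1 h).1

/-- Adjacent vertices outside `A` have nested or disjoint neighbourhoods in `A`. -/
theorem Ctx.nest (h : Ctx G A) {x y : V} (hx : x ∉ A) (hy : y ∉ A) (hxy : G.Adj x y)
    {c : V} (hcx : c ∈ nb G A x) (hcy : c ∈ nb G A y) :
    nb G A x ⊆ nb G A y ∨ nb G A y ⊆ nb G A x := by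
  by_contra hcon
  rw [not_or, Finset.not_subset, Finset.not_subset] at hcon
  obtain ⟨⟨s, hsx, hsy⟩, ⟨t, hty, htx⟩⟩ := hcon
  rw [mem_nb] at *
  have h1 : ¬ G.Adj y s := fun q => hsy ⟨hsx.1, q⟩
  have h2 : ¬ G.Adj x t := fun q => htx ⟨hty.1, q⟩
  have hst : t ≠ s := by rintro rfl; exact h1 hty.2
  have hct : c ≠ t := by rintro rfl; exact h2 hcx.2
  have hcs : c ≠ s := by rintro rfl; exact h1 hcy.2
  refine h.w4 x y t s c hxy hty.2 (h.clq _ hty.1 _ hsx.1 hst) hsx.2.symm ?_ h2 ?_ h1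
    hcx.2.symm hcy.2.symm (h.clq _ hcx.1 _ hty.1 hct) (h.clq _ hcx.1 _ hsx.1 hcs)
  · rintro rfl; exact hx hty.1
  · rintro rfl; exact hy hsx.1

theorem Ctx.trans (h : Ctx G A) {i j x y z : V} (hi : i ∈ A) (hj : j ∈ A) (hij : i ≠ j)
    (hx : ¬ G.Adj x i ∧ ¬ G.Adj x j) (hy : ¬ G.Adj y i ∧ ¬ G.Adj y j)
    (hz : ¬ G.Adj z i ∧ ¬ G.Adj z j) (hxy : G.Adj x y) (hyz : G.Adj y z) (hxz : x ≠ z) :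
    G.Adj x z := by
  by_contra hcon
  exact h.p3 x y z i j hxy hyz hxz hcon (h.clq _ hi _ hj hij) hx.1 hx.2 hy.1 hy.2 hz.1 hz.2

/-- two elements of `A` outside a small subset -/
theorem Ctx.two (_h : Ctx G A) {D : Finset V} (hD : D ⊆ A) (hc : D.card + 2 ≤ A.card) :
    ∃ i ∈ A, ∃ j ∈ A, i ≠ j ∧ i ∉ D ∧ j ∉ D := by
  classical
  have : 1 < (A \ D).card := by
    rw [Finset.card_sdiff_of_subset hD]; omega
  obtain ⟨i, hi, j, hj, hij⟩ := Finset.one_lt_card.1 this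
  rw [Finset.mem_sdiff] at hi hj
  exact ⟨i, hi.1, j, hj.1, hij, hi.2, hj.2⟩

theorem nadj_of {x i : V} {D : Finset V} (hs : nb G A x ⊆ D) (hi : i ∈ A) (hD : i ∉ D) :
    ¬ G.Adj x i := fun q => hD (hs (mem_nb.2 ⟨hi, q⟩))

/-- cliques outside `A` whose neighbourhoods lie in a small set are bounded by `K` -/
theorem KCtx.small (h : KCtx G A K a b) {P : Finset V}
    (hP : ∀ x ∈ P, ∀ y ∈ P, x ≠ y → G.Adj x y) (hPA : ∀ z ∈ P, z ∉ A) {D : Finset V}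
    (hD : D ⊆ A) (hc : D.card + 2 ≤ A.card) (hPD : ∀ z ∈ P, nb G A z ⊆ D) :
    P.card ≤ K.card := by
  obtain ⟨i, hi, j, hj, hij, hiD, hjD⟩ := h.two hD hc
  exact h.Kmax P hP hPA i hi j hj hij
    (fun z hz => ⟨nadj_of (hPD z hz) hi hiD, nadj_of (hPD z hz) hj hjD⟩)

/-- a vertex seeing exactly one of `a`, `b` misses at most one vertex of `K` -/
theorem KCtx.missOne (h : KCtx G A K a b) {z : V} (hz : z ∉ A)
    (hzab : (G.Adj z a ∧ ¬ G.Adj z b) ∨ (G.Adj z b ∧ ¬ G.Adj z a)) {c d : V}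
    (hc : c ∈ K) (hd : d ∈ K) (hcd : c ≠ d) (hzc : ¬ G.Adj z c) (hzd : ¬ G.Adj z d) : False := by
  have hadj := h.clq _ h.ha _ h.hb h.hab
  have k1 : ∀ {p q}, q ∈ K → (¬ G.Adj q p) → ¬ G.Adj p q := fun _ h1 h2 => h1 h2.symm
  rcases hzab with ⟨h1, h2⟩ | ⟨h1, h2⟩
  · refine h.p3 z a b c d h1 hadj ?_ h2 (h.Kclq _ hc _ hd hcd) hzc hzd
      (k1 hc (h.Ka _ hc)) (k1 hd (h.Ka _ hd)) (k1 hc (h.Kb _ hc)) (k1 hd (h.Kb _ hd))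
    rintro rfl; exact hz h.hb
  · refine h.p3 z b a c d h1 hadj.symm ?_ h2 (h.Kclq _ hc _ hd hcd) hzc hzd
      (k1 hc (h.Kb _ hc)) (k1 hd (h.Kb _ hd)) (k1 hc (h.Ka _ hc)) (k1 hd (h.Ka _ hd))
    rintro rfl; exact hz h.ha

open Classical in
/-- vertices of `K` complete to `Q` -/
noncomputable def comp (G : SimpleGraph V) (K Q : Finset V) : Finset V :=
  K.filter (fun c => ∀ w ∈ Q, G.Adj w c)

theorem mem_comp {Q : Finset V} {c : V} : c ∈ comp G K Q ↔ c ∈ K ∧ ∀ w ∈ Q, G.Adj w c := by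
  simp [comp]

theorem KCtx.compCard (h : KCtx G A K a b) (hK : 3 ≤ K.card) {Q : Finset V}
    (hQ : ∀ x ∈ Q, ∀ y ∈ Q, x ≠ y → G.Adj x y) (hQA : ∀ z ∈ Q, z ∉ A)
    (hQab : ∀ z ∈ Q, (G.Adj z a ∧ ¬ G.Adj z b) ∨ (G.Adj z b ∧ ¬ G.Adj z a)) :
    K.card ≤ (comp G K Q).card + 1 := by
  classical
  by_contra hcon
  have hsub : comp G K Q ⊆ K := fun _ hc => (mem_comp.1 hc).1
  have : 1 < (K \ comp G K Q).card := by
    rw [Finset.card_sdiff_of_subset hsub]; omega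
  obtain ⟨k, hk, l, hl, hkl⟩ := Finset.one_lt_card.1 this
  rw [Finset.mem_sdiff, mem_comp] at hk hl
  obtain ⟨hkK, hk⟩ := hk
  obtain ⟨hlK, hl⟩ := hl
  simp only [hkK, hlK, true_and, not_forall] at hk hl
  obtain ⟨w, hw, hwk⟩ := hk
  obtain ⟨w', hw', hwl⟩ := hl
  have key : ∀ z ∈ Q, ∀ c ∈ K, ∀ d ∈ K, c ≠ d → ¬ G.Adj z c → G.Adj z d := by
    intro z hz c hc d hd hcd h1
    by_contra h2
    exact h.missOne (hQA z hz) (hQab z hz) hc hd hcd h1 h2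
  have hwl' := key w hw k hkK l hlK hkl hwk
  have hwk' := key w' hw' l hlK k hkK hkl.symm hwl
  have hne : w ≠ w' := by rintro rfl; exact hwk hwk'
  have : 0 < ((K.erase k).erase l).card := by
    rw [Finset.card_erase_of_mem (Finset.mem_erase.2 ⟨hkl.symm, hlK⟩),
      Finset.card_erase_of_mem hkK]; omega
  obtain ⟨m, hm⟩ := Finset.card_pos.1 this
  simp only [Finset.mem_erase] at hm
  obtain ⟨hml, hmk, hmK⟩ := hm
  have nz : ∀ z ∈ Q, ∀ c ∈ K, z ≠ c := by
    rintro z hz c hc rfl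
    rcases hQab z hz with q | q
    · exact h.Ka _ hc q.1
    · exact h.Kb _ hc q.1
  exact h.w4 w w' k l m (hQ _ hw _ hw' hne) hwk' (h.Kclq _ hkK _ hlK hkl) hwl'.symm
    (nz _ hw _ hkK) hwk (nz _ hw' _ hlK) hwl (key w hw k hkK m hmK hmk.symm hwk).symm
    (key w' hw' l hlK m hmK hml.symm hwl).symm (h.Kclq _ hmK _ hkK hmk) (h.Kclq _ hmK _ hlK hml)

theorem clique_union [DecidableEq V] {P Q : Finset V}
    (hP : ∀ x ∈ P, ∀ y ∈ P, x ≠ y → G.Adj x y)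
    (hQ : ∀ x ∈ Q, ∀ y ∈ Q, x ≠ y → G.Adj x y) (hPQ : ∀ x ∈ P, ∀ y ∈ Q, G.Adj x y) :
    ∀ x ∈ P ∪ Q, ∀ y ∈ P ∪ Q, x ≠ y → G.Adj x y := by
  intro x hx y hy hxy
  rw [Finset.mem_union] at hx hy
  rcases hx with hx | hx <;> rcases hy with hy | hy
  · exact hP _ hx _ hy hxy
  · exact hPQ _ hx _ hy
  · exact (hPQ _ hy _ hx).symm
  · exact hQ _ hx _ hy hxy

theorem card_union_of_adj [DecidableEq V] {P Q : Finset V}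
    (hPQ : ∀ x ∈ P, ∀ y ∈ Q, G.Adj x y) : (P ∪ Q).card = P.card + Q.card := by
  apply Finset.card_union_of_disjoint
  rw [Finset.disjoint_left]
  intro x hx hx'
  exact G.irrefl (hPQ x hx x hx')

theorem KCtx.compBound (h : KCtx G A K a b) (hK : 3 ≤ K.card) {Q : Finset V}
    (hQ : ∀ x ∈ Q, ∀ y ∈ Q, x ≠ y → G.Adj x y) (hQA : ∀ z ∈ Q, z ∉ A)
    (hQab : ∀ z ∈ Q, (G.Adj z a ∧ ¬ G.Adj z b) ∨ (G.Adj z b ∧ ¬ G.Adj z a)) :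
    Q.card + K.card ≤ A.card + 1 := by
  classical
  have h1 := h.compCard hK hQ hQA hQab
  have hadj : ∀ x ∈ Q, ∀ y ∈ comp G K Q, G.Adj x y := fun x hx y hy => (mem_comp.1 hy).2 x hx
  have h2 := h.max _ (clique_union hQ (fun x hx y hy => h.Kclq _ (mem_comp.1 hx).1 _
    (mem_comp.1 hy).1) hadj)
  rw [card_union_of_adj hadj] at h2
  omega

/-- joining two cliques along an edge -/
theorem Ctx.join (h : Ctx G A) {i j : V} (hi : i ∈ A) (hj : j ∈ A) (hij : i ≠ j)
    {P U : Finset V} (hP : ∀ x ∈ P, ∀ y ∈ P, x ≠ y → G.Adj x y)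
    (hU : ∀ x ∈ U, ∀ y ∈ U, x ≠ y → G.Adj x y)
    (hPn : ∀ z ∈ P, ¬ G.Adj z i ∧ ¬ G.Adj z j) (hUn : ∀ z ∈ U, ¬ G.Adj z i ∧ ¬ G.Adj z j)
    (hne : ∀ x ∈ P, ∀ y ∈ U, x ≠ y) {x y : V} (hx : x ∈ P) (hy : y ∈ U) (hxy : G.Adj x y) :
    ∀ w ∈ P, ∀ u ∈ U, G.Adj w u := by
  intro w hw u hu
  have h1 : G.Adj w y := by
    by_cases hwx : w = x
    · rw [hwx]; exact hxy
    · exact h.trans hi hj hij (hPn w hw) (hPn x hx) (hUn y hy) (hP _ hw _ hx hwx) hxy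
        (hne _ hw _ hy)
  by_cases huy : u = y
  · rw [huy]; exact h1
  · exact h.trans hi hj hij (hPn w hw) (hUn y hy) (hUn u hu) h1 (hU _ hy _ hu (Ne.symm huy))
      (hne _ hw _ hu)

/-- Covering property, two vertices of `K`. -/
theorem KCtx.cover2 (h : KCtx G A K a b) {P S : Finset V}
    (hP : ∀ x ∈ P, ∀ y ∈ P, x ≠ y → G.Adj x y) (hPA : ∀ z ∈ P, z ∉ A)
    (hPS : ∀ z ∈ P, nb G A z ⊆ S) (hPa : ∀ z ∈ P, G.Adj z a) (hbS : b ∉ S)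
    (hcard : K.card ≤ P.card + 1) {c k : V} (hc : c ∈ comp G K P) (hk : k ∈ K) (hck : c ≠ k)
    {v : V} (hv : v ∈ A) (hvb : v ≠ b) : v ∈ S ∨ G.Adj c v ∨ G.Adj k v := by
  classical
  by_contra hcon
  simp only [not_or] at hcon
  obtain ⟨hvS, hcv, hkv⟩ := hcon
  rw [mem_comp] at hc
  obtain ⟨hcK, hc⟩ := hc
  have hPn : ∀ z ∈ P, ¬ G.Adj z v ∧ ¬ G.Adj z b := fun z hz =>
    ⟨nadj_of (hPS z hz) hv hvS, nadj_of (hPS z hz) h.hb hbS⟩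
  have hcn : ¬ G.Adj c v ∧ ¬ G.Adj c b := ⟨hcv, h.Kb _ hcK⟩
  have hkn : ¬ G.Adj k v ∧ ¬ G.Adj k b := ⟨hkv, h.Kb _ hk⟩
  have hall : ∀ w ∈ P, G.Adj w k := by
    intro w hw
    refine h.trans hv h.hb hvb (hPn w hw) hcn hkn (hc w hw) (h.Kclq _ hcK _ hk hck) ?_
    rintro rfl
    exact h.Ka _ hk (hPa _ hw)
  have hadj : ∀ x ∈ P, ∀ y ∈ ({c, k} : Finset V), G.Adj x y := by
    intro x hx y hy
    simp only [Finset.mem_insert, Finset.mem_singleton] at hy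
    rcases hy with rfl | rfl
    · exact hc x hx
    · exact hall x hx
  have hmem : ∀ y ∈ ({c, k} : Finset V), y ∈ K := by
    intro y hy
    simp only [Finset.mem_insert, Finset.mem_singleton] at hy
    rcases hy with rfl | rfl <;> assumption
  have hmax := h.Kmax (P ∪ {c, k}) (clique_union hP
    (fun x hx y hy => h.Kclq _ (hmem x hx) _ (hmem y hy)) hadj) ?_ v hv b h.hb hvb ?_
  · rw [card_union_of_adj hadj, Finset.card_pair hck] at hmax
    omega
  · intro z hz
    rcases Finset.mem_union.1 hz with hz | hz
    · exact hPA z hz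
    · exact h.Kdis z (hmem z hz)
  · intro z hz
    rcases Finset.mem_union.1 hz with hz | hz
    · exact hPn z hz
    · simp only [Finset.mem_insert, Finset.mem_singleton] at hz
      rcases hz with rfl | rfl <;> assumption

/-- Covering property, one vertex of `K`, if `P` is as large as `K`. -/
theorem KCtx.cover1 (h : KCtx G A K a b) {P S : Finset V}
    (hP : ∀ x ∈ P, ∀ y ∈ P, x ≠ y → G.Adj x y) (hPA : ∀ z ∈ P, z ∉ A)
    (hPS : ∀ z ∈ P, nb G A z ⊆ S) (hbS : b ∉ S)
    (hcard : K.card ≤ P.card) {c : V} (hc : c ∈ comp G K P)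
    {v : V} (hv : v ∈ A) (hvb : v ≠ b) : v ∈ S ∨ G.Adj c v := by
  classical
  by_contra hcon
  simp only [not_or] at hcon
  obtain ⟨hvS, hcv⟩ := hcon
  rw [mem_comp] at hc
  obtain ⟨hcK, hc⟩ := hc
  have hadj : ∀ x ∈ P, ∀ y ∈ ({c} : Finset V), G.Adj x y := by
    intro x hx y hy
    rw [Finset.mem_singleton] at hy
    subst hy
    exact hc x hx
  have hmax := h.Kmax (P ∪ {c}) (clique_union hP ?_ hadj) ?_ v hv b h.hb hvb ?_
  · rw [card_union_of_adj hadj, Finset.card_singleton] at hmax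
    omega
  · intro x hx y hy hxy
    rw [Finset.mem_singleton] at hx hy
    exact absurd (hx.trans hy.symm) hxy
  · intro z hz
    rcases Finset.mem_union.1 hz with hz | hz
    · exact hPA z hz
    · rw [Finset.mem_singleton] at hz; subst hz; exact h.Kdis _ hcK
  · intro z hz
    rcases Finset.mem_union.1 hz with hz | hz
    · exact ⟨nadj_of (hPS z hz) hv hvS, nadj_of (hPS z hz) h.hb hbS⟩
    · rw [Finset.mem_singleton] at hz; subst hz; exact ⟨hcv, h.Kb _ hcK⟩

/-- a vertex of `K` complete to `P` that sees a vertex of `N(x)` has `N(c) ⊆ N(x)` -/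
theorem KCtx.subS (h : KCtx G A K a b) {P : Finset V} {x c v : V} (hx : x ∈ P) (hxA : x ∉ A)
    (hxa : G.Adj x a) (hc : c ∈ comp G K P) (hv : v ∈ nb G A x) (hcv : G.Adj c v) :
    nb G A c ⊆ nb G A x := by
  rw [mem_comp] at hc
  rcases h.nest hxA (h.Kdis _ hc.1) (hc.2 x hx) hv (mem_nb.2 ⟨(mem_nb.1 hv).1, hcv⟩) with q | q
  · exact absurd (mem_nb.1 (q (mem_nb.2 ⟨h.ha, hxa⟩))).2 (h.Ka _ hc.1)
  · exact q

theorem not_all {S : Finset V} (hS : S.card + 2 ≤ A.card) (hb : b ∈ A)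
    (hall : ∀ v ∈ A, v ≠ b → v ∈ S) : False := by
  classical
  have : A.erase b ⊆ S := fun v hv => hall v (Finset.mem_of_mem_erase hv) (Finset.ne_of_mem_erase hv)
  have := Finset.card_le_card this
  rw [Finset.card_erase_of_mem hb] at this
  omega

/-- If `K` has at least four vertices, `N(x) = {a}`. -/
theorem KCtx.single (h : KCtx G A K a b) (hK : 4 ≤ K.card) {P U : Finset V} {x y : V}
    (hP : ∀ x ∈ P, ∀ y ∈ P, x ≠ y → G.Adj x y) (hPA : ∀ z ∈ P, z ∉ A)
    (hPS : ∀ z ∈ P, nb G A z ⊆ nb G A x) (hPa : ∀ z ∈ P, G.Adj z a) (hbS : b ∉ nb G A x)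
    (hU : ∀ x ∈ U, ∀ y ∈ U, x ≠ y → G.Adj x y) (hUA : ∀ z ∈ U, z ∉ A)
    (hUS : ∀ z ∈ U, nb G A z ⊆ nb G A y) (hUb : ∀ z ∈ U, G.Adj z b) (haT : a ∉ nb G A y)
    (hx : x ∈ P) (hSc : (nb G A x).card + 2 ≤ A.card)
    (hdis : ∀ v ∈ nb G A x, v ∉ nb G A y)
    (hpc : K.card ≤ P.card + 1) (hqc : K.card ≤ U.card + 1)
    (hKP : K.card ≤ (comp G K P).card + 1) (hKU : K.card ≤ (comp G K U).card + 1) :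
    ∀ v ∈ nb G A x, v = a := by
  classical
  intro v hv
  by_contra hva
  have hvA := nb_sub x hv
  have hvT := hdis v hv
  have hsP : comp G K P ⊆ K := fun _ hc => (mem_comp.1 hc).1
  have hsU : comp G K U ⊆ K := fun _ hc => (mem_comp.1 hc).1
  have hinter : 1 < (comp G K P ∩ comp G K U).card := by
    have h1 := Finset.card_union_add_card_inter (comp G K P) (comp G K U)
    have h2 := Finset.card_le_card (Finset.union_subset hsP hsU)
    omega
  obtain ⟨c, hc, k, hk, hck⟩ := Finset.one_lt_card.1 hinter
  rw [Finset.mem_inter] at hc hk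
  have : 0 < (((comp G K P).erase c).erase k).card := by
    rw [Finset.card_erase_of_mem (Finset.mem_erase.2 ⟨hck.symm, hk.1⟩),
      Finset.card_erase_of_mem hc.1]; omega
  obtain ⟨m, hm⟩ := Finset.card_pos.1 this
  simp only [Finset.mem_erase] at hm
  obtain ⟨hmk, hmc, hm⟩ := hm
  have cov : ∀ {c k : V}, c ∈ comp G K U → k ∈ K → c ≠ k → G.Adj c v ∨ G.Adj k v := by
    intro c k hc hk hck
    rcases h.symm.cover2 hU hUA hUS hUb haT hqc hc hk hck hvA hva with q | q
    · exact absurd q hvT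
    · exact q
  have bad : ∀ {c k : V}, c ∈ comp G K P → k ∈ comp G K P → c ≠ k → G.Adj c v → G.Adj k v →
      False := by
    intro c k hc hk hck hcv hkv
    have hxA := hPA x hx
    have s1 := h.subS hx hxA (hPa x hx) hc hv hcv
    have s2 := h.subS hx hxA (hPa x hx) hk hv hkv
    refine not_all hSc h.hb ?_
    intro t ht htb
    rcases h.cover2 hP hPA hPS hPa hbS hpc hc (hsP hk) hck ht htb with q | q | q
    · exact q
    · exact s1 (mem_nb.2 ⟨ht, q⟩)
    · exact s2 (mem_nb.2 ⟨ht, q⟩)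
  have c1 := cov hc.2 (hsP hk.1) hck
  have c2 := cov hc.2 (hsP hm) hmc.symm
  have c3 := cov hk.2 (hsP hm) hmk.symm
  rcases c1 with q | q
  · rcases c3 with r | r
    · exact bad hc.1 hk.1 hck q r
    · exact bad hc.1 hm hmc.symm q r
  · rcases c2 with r | r
    · exact bad hc.1 hk.1 hck r q
    · exact bad hk.1 hm hmk.symm q r

/-- If `P` is as large as `K`, both neighbourhoods are singletons. -/
theorem KCtx.single3 (h : KCtx G A K a b) (hK : 3 ≤ K.card) {P U : Finset V} {x y : V}
    (hP : ∀ x ∈ P, ∀ y ∈ P, x ≠ y → G.Adj x y) (hPA : ∀ z ∈ P, z ∉ A)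
    (hPS : ∀ z ∈ P, nb G A z ⊆ nb G A x) (hPa : ∀ z ∈ P, G.Adj z a) (hbS : b ∉ nb G A x)
    (hU : ∀ x ∈ U, ∀ y ∈ U, x ≠ y → G.Adj x y) (hUA : ∀ z ∈ U, z ∉ A)
    (hUS : ∀ z ∈ U, nb G A z ⊆ nb G A y) (hUb : ∀ z ∈ U, G.Adj z b) (haT : a ∉ nb G A y)
    (hx : x ∈ P) (hy : y ∈ U) (hSc : (nb G A x).card + 2 ≤ A.card)
    (hTc : (nb G A y).card + 2 ≤ A.card)
    (hdis : ∀ v ∈ nb G A x, v ∉ nb G A y)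
    (hpc : K.card ≤ P.card) (hqc : K.card ≤ U.card + 1)
    (hKP : K.card ≤ (comp G K P).card + 1) (hKU : K.card ≤ (comp G K U).card + 1) :
    (∀ v ∈ nb G A x, v = a) ∧ ∀ v ∈ nb G A y, v = b := by
  classical
  have hsP : comp G K P ⊆ K := fun _ hc => (mem_comp.1 hc).1
  have hsU : comp G K U ⊆ K := fun _ hc => (mem_comp.1 hc).1
  have hinter : 0 < (comp G K P ∩ comp G K U).card := by
    have h1 := Finset.card_union_add_card_inter (comp G K P) (comp G K U)
    have h2 := Finset.card_le_card (Finset.union_subset hsP hsU)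
    omega
  obtain ⟨c, hc⟩ := Finset.card_pos.1 hinter
  rw [Finset.mem_inter] at hc
  have : 0 < ((comp G K P).erase c).card := by
    rw [Finset.card_erase_of_mem hc.1]; omega
  obtain ⟨m, hm⟩ := Finset.card_pos.1 this
  simp only [Finset.mem_erase] at hm
  obtain ⟨hmc, hm⟩ := hm
  have hS : ∀ v ∈ nb G A x, v = a := by
    intro v hv
    by_contra hva
    have bad : ∀ {c : V}, c ∈ comp G K P → G.Adj c v → False := by
      intro c hc hcv
      have s1 := h.subS hx (hPA x hx) (hPa x hx) hc hv hcv
      refine not_all hSc h.hb ?_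
      intro t ht htb
      rcases h.cover1 hP hPA hPS hbS hpc hc ht htb with q | q
      · exact q
      · exact s1 (mem_nb.2 ⟨ht, q⟩)
    rcases h.symm.cover2 hU hUA hUS hUb haT hqc hc.2 (hsP hm) hmc.symm (nb_sub x hv) hva
      with q | q | q
    · exact hdis v hv q
    · exact bad hc.1 q
    · exact bad hm q
  refine ⟨hS, ?_⟩
  intro v hv
  by_contra hvb
  have hcv : G.Adj c v := by
    rcases h.cover1 hP hPA hPS hbS hpc hc.1 (nb_sub y hv) hvb with q | q
    · exact absurd hv (hdis v q)
    · exact q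
  have s1 := h.symm.subS hy (hUA y hy) (hUb y hy) hc.2 hv hcv
  refine not_all hTc h.ha ?_
  intro t ht hta
  by_cases htb : t = b
  · rw [htb]; exact mem_nb.2 ⟨h.hb, hUb y hy⟩
  · rcases h.cover1 hP hPA hPS hbS hpc hc.1 ht htb with q | q
    · exact absurd (hS t q) hta
    · exact s1 (mem_nb.2 ⟨ht, q⟩)

/-- The main estimate. -/
theorem KCtx.main (h : KCtx G A K a b) {P U : Finset V} {x y : V}
    (hP : ∀ x ∈ P, ∀ y ∈ P, x ≠ y → G.Adj x y) (hPA : ∀ z ∈ P, z ∉ A)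
    (hPS : ∀ z ∈ P, nb G A z ⊆ nb G A x) (hPa : ∀ z ∈ P, G.Adj z a)
    (hU : ∀ x ∈ U, ∀ y ∈ U, x ≠ y → G.Adj x y) (hUA : ∀ z ∈ U, z ∉ A)
    (hUS : ∀ z ∈ U, nb G A z ⊆ nb G A y) (hUb : ∀ z ∈ U, G.Adj z b)
    (hUa : ∀ z ∈ U, ¬ G.Adj z a)
    (hx : x ∈ P) (hy : y ∈ U) (hSc : (nb G A x).card + 2 ≤ A.card)
    (hTc : (nb G A y).card + 2 ≤ A.card) (hxy : G.Adj x y) :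
    P.card + U.card + 1 ≤ A.card := by
  classical
  have hne : ∀ x ∈ P, ∀ y ∈ U, x ≠ y := by
    rintro x hx y hy rfl; exact hUa _ hy (hPa _ hx)
  have haT : a ∉ nb G A y := fun q => hUa y hy (mem_nb.1 q).2
  have haS : a ∈ nb G A x := mem_nb.2 ⟨h.ha, hPa x hx⟩
  have hbT : b ∈ nb G A y := mem_nb.2 ⟨h.hb, hUb y hy⟩
  have hKA := h.max K h.Kclq
  have h5 := h.five
  have hPUA : ∀ z ∈ P ∪ U, z ∉ A := by
    intro z hz
    rcases Finset.mem_union.1 hz with hz | hz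
    · exact hPA z hz
    · exact hUA z hz
  have hjoin : ∀ i ∈ A, ∀ j ∈ A, i ≠ j → (∀ z ∈ P, ¬ G.Adj z i ∧ ¬ G.Adj z j) →
      (∀ z ∈ U, ¬ G.Adj z i ∧ ¬ G.Adj z j) →
      (∀ w ∈ P, ∀ u ∈ U, G.Adj w u) ∧ P.card + U.card ≤ K.card := by
    intro i hi j hj hij h1 h2
    have hadj := h.join hi hj hij hP hU h1 h2 hne hx hy hxy
    refine ⟨hadj, ?_⟩
    rw [← card_union_of_adj hadj]
    refine h.Kmax _ (clique_union hP hU hadj) hPUA i hi j hj hij ?_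
    intro z hz
    rcases Finset.mem_union.1 hz with hz | hz
    · exact h1 z hz
    · exact h2 z hz
  by_cases hbS : b ∈ nb G A x
  · have hTS : nb G A y ⊆ nb G A x := by
      rcases h.nest (hPA x hx) (hUA y hy) hxy hbS hbT with q | q
      · exact absurd (q haS) haT
      · exact q
    obtain ⟨i, hi, j, hj, hij, hi', hj'⟩ := h.two (nb_sub x) hSc
    obtain ⟨hadj, hle⟩ := hjoin i hi j hj hij
      (fun z hz => ⟨nadj_of (hPS z hz) hi hi', nadj_of (hPS z hz) hj hj'⟩)
      (fun z hz => ⟨nadj_of ((hUS z hz).trans hTS) hi hi', nadj_of ((hUS z hz).trans hTS) hj hj'⟩)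
    by_cases hall : ∀ w ∈ P, G.Adj w b
    · have hadj2 : ∀ z ∈ P ∪ U, ∀ t ∈ ({b} : Finset V), G.Adj z t := by
        intro z hz t ht
        rw [Finset.mem_singleton] at ht
        subst ht
        rcases Finset.mem_union.1 hz with hz | hz
        · exact hall z hz
        · exact hUb z hz
      have := h.max _ (clique_union (clique_union hP hU hadj) (by
        intro x hx y hy hxy
        rw [Finset.mem_singleton] at hx hy
        exact absurd (hx.trans hy.symm) hxy) hadj2)
      rw [card_union_of_adj hadj2, card_union_of_adj hadj, Finset.card_singleton] at this
      exact this
    · simp only [not_forall] at hall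
      obtain ⟨w, hw, hwb⟩ := hall
      by_cases hK : 3 ≤ K.card
      · have hwy := hadj w hw y hy
        have := h.compBound hK (Q := {w, y}) ?_ ?_ ?_
        · rw [Finset.card_pair (hne w hw y hy)] at this
          omega
        · intro p hp q hq hpq
          simp only [Finset.mem_insert, Finset.mem_singleton] at hp hq
          rcases hp with rfl | rfl <;> rcases hq with rfl | rfl
          · exact absurd rfl hpq
          · exact hwy
          · exact hwy.symm
          · exact absurd rfl hpq
        · intro p hp
          simp only [Finset.mem_insert, Finset.mem_singleton] at hp
          rcases hp with rfl | rfl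
          · exact hPA _ hw
          · exact hUA _ hy
        · intro p hp
          simp only [Finset.mem_insert, Finset.mem_singleton] at hp
          rcases hp with rfl | rfl
          · exact Or.inl ⟨hPa _ hw, hwb⟩
          · exact Or.inr ⟨hUb _ hy, hUa _ hy⟩
      · omega
  · have hdis : ∀ v ∈ nb G A x, v ∉ nb G A y := by
      intro v hv hv'
      rcases h.nest (hPA x hx) (hUA y hy) hxy hv hv' with q | q
      · exact haT (q haS)
      · exact hbS (q hbT)
    have hp := h.small hP hPA (nb_sub x) hSc hPS
    have hq := h.small hU hUA (nb_sub y) hTc hUS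
    by_contra hcon
    have hK : 3 ≤ K.card := by omega
    have hPab : ∀ z ∈ P, (G.Adj z a ∧ ¬ G.Adj z b) ∨ (G.Adj z b ∧ ¬ G.Adj z a) := fun z hz =>
      Or.inl ⟨hPa z hz, nadj_of (hPS z hz) h.hb hbS⟩
    have hUab : ∀ z ∈ U, (G.Adj z a ∧ ¬ G.Adj z b) ∨ (G.Adj z b ∧ ¬ G.Adj z a) := fun z hz =>
      Or.inr ⟨hUb z hz, hUa z hz⟩
    have hP1 := h.compBound hK hP hPA hPab
    have hU1 := h.compBound hK hU hUA hUab
    have hKP := h.compCard hK hP hPA hPab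
    have hKU := h.compCard hK hU hUA hUab
    have hpc : K.card ≤ P.card + 1 := by omega
    have hqc : K.card ≤ U.card + 1 := by omega
    have hdis' : ∀ v ∈ nb G A y, v ∉ nb G A x := fun v hv hv' => hdis v hv' hv
    have hST : (∀ v ∈ nb G A x, v = a) ∧ ∀ v ∈ nb G A y, v = b := by
      by_cases hK4 : 4 ≤ K.card
      · have comm1 := h.symm.single hK4 hU hUA hUS hUb haT hP hPA hPS hPa hbS hy hTc hdis'
          hqc hpc hKU hKP
        exact ⟨h.single hK4 hP hPA hPS hPa hbS hU hUA hUS hUb haT hx hSc hdis hpc hqc hKP hKU,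
          comm1⟩
      · by_cases hpK : K.card ≤ P.card
        · exact h.single3 hK hP hPA hPS hPa hbS hU hUA hUS hUb haT hx hy hSc hTc hdis hpK hqc
            hKP hKU
        · have hqK : K.card ≤ U.card := by omega
          exact (h.symm.single3 hK hU hUA hUS hUb haT hP hPA hPS hPa hbS hy hx hTc hSc hdis' hqK
            hpc hKU hKP).symm
    obtain ⟨i, hi, j, hj, hij, hi', hj'⟩ := h.two (D := {a, b}) (by
      intro t ht
      simp only [Finset.mem_insert, Finset.mem_singleton] at ht
      rcases ht with rfl | rfl
      · exact h.ha
      · exact h.hb) (by rw [Finset.card_pair h.hab]; omega)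
    simp only [Finset.mem_insert, Finset.mem_singleton, not_or] at hi' hj'
    obtain ⟨-, hle⟩ := hjoin i hi j hj hij
      (fun z hz => ⟨nadj_of (hPS z hz) hi (fun q => hi'.1 (hST.1 i q)),
        nadj_of (hPS z hz) hj (fun q => hj'.1 (hST.1 j q))⟩)
      (fun z hz => ⟨nadj_of (hUS z hz) hi (fun q => hi'.2 (hST.2 i q)),
        nadj_of (hUS z hz) hj (fun q => hj'.2 (hST.2 j q))⟩)
    omega


/-- an injective ranking refining the size of the neighbourhood in `A` -/
theorem exists_rank [Fintype V] (G : SimpleGraph V) (A : Finset V) :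
    ∃ r : V → ℕ, Function.Injective r ∧
      ∀ w x, r w ≤ r x → (nb G A w).card ≤ (nb G A x).card := by
  classical
  let e := Fintype.equivFin V
  have key : ∀ w x, (nb G A w).card * Fintype.card V + (e w : ℕ) ≤
      (nb G A x).card * Fintype.card V + (e x : ℕ) → (nb G A w).card ≤ (nb G A x).card := by
    intro w x hle
    by_contra hlt
    have h1 : (nb G A x).card + 1 ≤ (nb G A w).card := by omega
    have h2 := Nat.mul_le_mul_right (Fintype.card V) h1
    have h3 := (e x).isLt
    rw [Nat.add_mul, Nat.one_mul] at h2
    omega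
  refine ⟨fun x => (nb G A x).card * Fintype.card V + (e x : ℕ), ?_, key⟩
  intro w x hwx
  have hwx' : (nb G A w).card * Fintype.card V + (e w : ℕ) =
      (nb G A x).card * Fintype.card V + (e x : ℕ) := hwx
  have hc := le_antisymm (key w x hwx'.le) (key x w hwx'.ge)
  rw [hc] at hwx'
  exact e.injective (Fin.ext (by omega))

/-- The height function on a family of vertices sharing a neighbour `c` in `A`. -/
theorem Ctx.height [Fintype V] (h : Ctx G A) {c : V} (hc : c ∈ A) (H : V → Prop)
    (hHA : ∀ x, H x → x ∉ A) (hHc : ∀ x, H x → G.Adj x c)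
    (hHs : ∀ x, H x → (nb G A x).card + 2 ≤ A.card) :
    ∃ f : V → ℕ, (∀ x y, H x → H y → G.Adj x y → f x ≠ f y) ∧
      ∀ x, H x → 1 ≤ f x ∧ f x + 1 ≤ A.card ∧ ∃ P : Finset V, x ∈ P ∧ P.card = f x ∧
        (∀ y ∈ P, ∀ z ∈ P, y ≠ z → G.Adj y z) ∧ ∀ z ∈ P, H z ∧ nb G A z ⊆ nb G A x := by
  classical
  obtain ⟨r, rinj, rle⟩ := exists_rank G A
  have hsub : ∀ w x, H w → H x → r w ≤ r x → (w = x ∨ G.Adj w x) → nb G A w ⊆ nb G A x := by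
    intro w x hw hx hle hwx
    rcases hwx with rfl | hwx
    · exact Finset.Subset.refl _
    rcases h.nest (hHA w hw) (hHA x hx) hwx (mem_nb.2 ⟨hc, hHc w hw⟩)
      (mem_nb.2 ⟨hc, hHc x hx⟩) with h1 | h1
    · exact h1
    · exact (Finset.eq_of_subset_of_card_le h1 (rle w x hle)).ge
  let F : V → Finset (Finset V) := fun x => Finset.univ.filter (fun Q =>
    x ∈ Q ∧ (∀ y ∈ Q, ∀ z ∈ Q, y ≠ z → G.Adj y z) ∧ ∀ z ∈ Q, H z ∧ r z ≤ r x)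
  have memF : ∀ x Q, Q ∈ F x ↔
      x ∈ Q ∧ (∀ y ∈ Q, ∀ z ∈ Q, y ≠ z → G.Adj y z) ∧ ∀ z ∈ Q, H z ∧ r z ≤ r x := by
    intro x Q; simp [F]
  have hne : ∀ x, H x → (F x).Nonempty := by
    intro x hx
    refine ⟨{x}, (memF _ _).2 ⟨by simp, ?_, ?_⟩⟩
    · intro y hy z hz hyz
      rw [Finset.mem_singleton] at hy hz
      exact absurd (hy.trans hz.symm) hyz
    · intro z hz
      rw [Finset.mem_singleton] at hz
      subst hz
      exact ⟨hx, le_refl _⟩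
  have wit : ∀ x, H x → ∃ P ∈ F x, P.card = (F x).sup Finset.card := by
    intro x hx
    obtain ⟨P, hP, hPe⟩ := Finset.exists_mem_eq_sup (F x) (hne x hx) Finset.card
    exact ⟨P, hP, hPe.symm⟩
  have sub2 : ∀ x, H x → ∀ P ∈ F x, ∀ z ∈ P, nb G A z ⊆ nb G A x := by
    intro x hx P hP z hz
    obtain ⟨h1, h2, h3⟩ := (memF _ _).1 hP
    refine hsub z x (h3 z hz).1 hx (h3 z hz).2 ?_
    by_cases hzx : z = x
    · exact Or.inl hzx
    · exact Or.inr (h2 z hz x h1 hzx)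
  have lt : ∀ x y, H x → H y → G.Adj x y → r x < r y →
      (F x).sup Finset.card + 1 ≤ (F y).sup Finset.card := by
    intro x y hx hy hxy hr
    obtain ⟨P, hP, hPc⟩ := wit x hx
    obtain ⟨h1, h2, h3⟩ := (memF _ _).1 hP
    obtain ⟨i, hi, j, hj, hij, hi', hj'⟩ := h.two (nb_sub y) (hHs y hy)
    have hxy' := hsub x y hx hy hr.le (Or.inr hxy)
    have nz : ∀ z ∈ P, ¬ G.Adj z i ∧ ¬ G.Adj z j := fun z hz =>
      ⟨nadj_of ((sub2 x hx P hP z hz).trans hxy') hi hi',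
        nadj_of ((sub2 x hx P hP z hz).trans hxy') hj hj'⟩
    have ny : ¬ G.Adj y i ∧ ¬ G.Adj y j :=
      ⟨nadj_of (Finset.Subset.refl _) hi hi', nadj_of (Finset.Subset.refl _) hj hj'⟩
    have hyP : y ∉ P := fun hyP => absurd (h3 y hyP).2 (by omega)
    have hadj : ∀ z ∈ P, G.Adj z y := by
      intro z hz
      by_cases hzx : z = x
      · subst hzx; exact hxy
      · refine h.trans hi hj hij (nz z hz) (nz x h1) ny (h2 z hz x h1 hzx) hxy ?_
        rintro rfl; exact hyP hz
    have hmem : insert y P ∈ F y := by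
      refine (memF _ _).2 ⟨Finset.mem_insert_self _ _, ?_, ?_⟩
      · intro u hu v hv huv
        rw [Finset.mem_insert] at hu hv
        rcases hu with rfl | hu <;> rcases hv with rfl | hv
        · exact absurd rfl huv
        · exact (hadj v hv).symm
        · exact hadj u hu
        · exact h2 u hu v hv huv
      · intro z hz
        rw [Finset.mem_insert] at hz
        rcases hz with rfl | hz
        · exact ⟨hy, le_refl _⟩
        · exact ⟨(h3 z hz).1, by have := (h3 z hz).2; omega⟩
    have := Finset.le_sup (f := Finset.card) hmem
    rw [Finset.card_insert_of_notMem hyP] at this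
    omega
  refine ⟨fun x => (F x).sup Finset.card, ?_, ?_⟩
  · intro x y hx hy hxy heq
    have heq' : (F x).sup Finset.card = (F y).sup Finset.card := heq
    rcases lt_trichotomy (r x) (r y) with h1 | h1 | h1
    · have := lt x y hx hy hxy h1; omega
    · exact G.ne_of_adj hxy (rinj h1)
    · have := lt y x hy hx hxy.symm h1; omega
  · intro x hx
    obtain ⟨P, hP, hPc⟩ := wit x hx
    obtain ⟨h1, h2, h3⟩ := (memF _ _).1 hP
    have hcP : c ∉ P := fun q => hHA c (h3 c q).1 hc
    have hpos : 0 < P.card := Finset.card_pos.2 ⟨x, h1⟩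
    have hle : (insert c P).card ≤ A.card := by
      refine h.max _ ?_
      intro u hu v hv huv
      rw [Finset.mem_insert] at hu hv
      rcases hu with rfl | hu <;> rcases hv with rfl | hv
      · exact absurd rfl huv
      · exact (hHc v (h3 v hv).1).symm
      · exact hHc u (h3 u hu).1
      · exact h2 u hu v hv huv
    rw [Finset.card_insert_of_notMem hcP] at hle
    have q1 : 1 ≤ (F x).sup Finset.card := by omega
    have q2 : (F x).sup Finset.card + 1 ≤ A.card := by omega
    exact ⟨q1, q2, P, h1, hPc, h2, fun z hz => ⟨(h3 z hz).1, sub2 x hx P hP z hz⟩⟩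

/-- A vertex outside `A` is not complete to `A`. -/
theorem Ctx.nb_card_lt (h : Ctx G A) {u : V} (hu : u ∉ A) : (nb G A u).card + 1 ≤ A.card := by
  classical
  have := h.max (insert u (nb G A u)) ?_
  · rwa [Finset.card_insert_of_notMem (fun q => hu (nb_sub u q))] at this
  · intro p hp q hq hpq
    rw [Finset.mem_insert, mem_nb] at hp hq
    rcases hp with rfl | hp <;> rcases hq with rfl | hq
    · exact absurd rfl hpq
    · exact hq.2
    · exact hp.2.symm
    · exact h.clq _ hp.1 _ hq.1 hpq

/-- Vertices outside `A` missing at most one vertex of `A` are pairwise nonadjacent. -/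
theorem Ctx.indep (h : Ctx G A) {u v : V} (hu : u ∉ A) (hv : v ∉ A)
    (hu' : ¬ (nb G A u).card + 2 ≤ A.card) (hv' : ¬ (nb G A v).card + 2 ≤ A.card) :
    ¬ G.Adj u v := by
  classical
  intro huv
  have h5 := h.five
  obtain ⟨c, hc⟩ : (nb G A u ∩ nb G A v).Nonempty := by
    rw [← Finset.card_pos]
    have h1 := Finset.card_union_add_card_inter (nb G A u) (nb G A v)
    have h2 := Finset.card_le_card (Finset.union_subset (nb_sub (G := G) (A := A) u)
      (nb_sub (G := G) (A := A) v))
    omega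
  rw [Finset.mem_inter] at hc
  have key : ∀ u v : V, u ∉ A → v ∉ A → ¬ (nb G A u).card + 2 ≤ A.card → G.Adj u v →
      nb G A u ⊆ nb G A v → False := by
    intro u v hu hv hu' huv hs
    have hle := h.max (insert u (insert v (nb G A u))) (by
      intro p hp q hq hpq
      have hv2 : ∀ z ∈ nb G A u, G.Adj v z := fun z hz => (mem_nb.1 (hs hz)).2
      have hu2 : ∀ z ∈ nb G A u, G.Adj u z := fun z hz => (mem_nb.1 hz).2
      rw [Finset.mem_insert, Finset.mem_insert] at hp hq
      rcases hp with rfl | rfl | hp <;> rcases hq with rfl | rfl | hq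
      · exact absurd rfl hpq
      · exact huv
      · exact hu2 q hq
      · exact huv.symm
      · exact absurd rfl hpq
      · exact hv2 q hq
      · exact (hu2 p hp).symm
      · exact (hv2 p hp).symm
      · exact h.clq _ (nb_sub _ hp) _ (nb_sub _ hq) hpq)
    have h1 : v ∉ nb G A u := fun q => hv (nb_sub u q)
    have h2 : u ∉ insert v (nb G A u) := by
      rw [Finset.mem_insert, not_or]
      exact ⟨G.ne_of_adj huv, fun q => hu (nb_sub u q)⟩
    rw [Finset.card_insert_of_notMem h2, Finset.card_insert_of_notMem h1] at hle
    omega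
  rcases h.nest hu hv huv hc.1 hc.2 with h1 | h1
  · exact key u v hu hv hu' huv h1
  · exact key v u hv hu hv' huv.symm h1

/-- A clique outside `A` can be matched into its non-neighbours in `A`. -/
theorem Ctx.hall (h : Ctx G A) (Q : Finset V) (hQ : ∀ x ∈ Q, ∀ y ∈ Q, x ≠ y → G.Adj x y)
    (hQA : ∀ z ∈ Q, z ∉ A) :
    ∃ g : V → V, (∀ z ∈ Q, g z ∈ A ∧ ¬ G.Adj z (g z)) ∧
      ∀ y ∈ Q, ∀ z ∈ Q, g y = g z → y = z := by
  classical
  let t : {z // z ∈ Q} → Finset V := fun z => A \ nb G A z.1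
  have hall : ∀ s : Finset {z // z ∈ Q}, s.card ≤ (s.biUnion t).card := by
    intro s
    let D := A.filter (fun v => ∀ z ∈ s, G.Adj z.1 v)
    have hDA : D ⊆ A := Finset.filter_subset _ _
    have hun : s.biUnion t = A \ D := by
      ext v
      simp only [Finset.mem_biUnion, t, D, Finset.mem_sdiff, Finset.mem_filter, mem_nb]
      constructor
      · rintro ⟨z, hz, hv, hn⟩
        exact ⟨hv, fun q => hn ⟨hv, q.2 z hz⟩⟩
      · rintro ⟨hv, hn⟩
        by_contra hcon
        refine hn ⟨hv, fun z hz => ?_⟩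
        by_contra hzv
        exact hcon ⟨z, hz, hv, fun q => hzv q.2⟩
    have hle := h.max (s.map (Function.Embedding.subtype _) ∪ D) (by
      intro p hp q hq hpq
      simp only [Finset.mem_union, Finset.mem_map, Function.Embedding.subtype_apply] at hp hq
      rcases hp with ⟨p, hp, rfl⟩ | hp <;> rcases hq with ⟨q, hq, rfl⟩ | hq
      · exact hQ _ p.2 _ q.2 hpq
      · exact (Finset.mem_filter.1 hq).2 p hp
      · exact ((Finset.mem_filter.1 hp).2 q hq).symm
      · exact h.clq _ (hDA hp) _ (hDA hq) hpq)
    rw [Finset.card_union_of_disjoint, Finset.card_map] at hle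
    · rw [hun, Finset.card_sdiff_of_subset hDA]; omega
    · rw [Finset.disjoint_left]
      intro v hv hvD
      obtain ⟨z, _, rfl⟩ := Finset.mem_map.1 hv
      exact hQA _ z.2 (hDA hvD)
  obtain ⟨f, finj, hf⟩ := (Finset.all_card_le_biUnion_card_iff_exists_injective t).1 hall
  refine ⟨fun z => if hz : z ∈ Q then f ⟨z, hz⟩ else z, ?_, ?_⟩
  · intro z hz
    have := hf ⟨z, hz⟩
    simp only [t, Finset.mem_sdiff, mem_nb] at this
    simp only [hz, dif_pos]
    exact ⟨this.1, fun q => this.2 ⟨this.1, q⟩⟩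
  · intro y hy z hz hyz
    simp only [hy, hz, dif_pos] at hyz
    exact congrArg Subtype.val (finj hyz)

/-- Colouring the vertices missing both `a` and `b`. -/
theorem KCtx.colC [Fintype V] (h : KCtx G A K a b) :
    ∃ g : V → V, (∀ z, z ∉ A → ¬ G.Adj z a → ¬ G.Adj z b → g z ∈ A ∧ ¬ G.Adj z (g z)) ∧
      ∀ y z, y ∉ A → ¬ G.Adj y a → ¬ G.Adj y b → z ∉ A → ¬ G.Adj z a → ¬ G.Adj z b →
        G.Adj y z → g y ≠ g z := by
  classical
  let cl : V → Finset V := fun z => Finset.univ.filter (fun w =>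
    (w ∉ A ∧ ¬ G.Adj w a ∧ ¬ G.Adj w b) ∧ (w = z ∨ G.Adj w z))
  have mcl : ∀ z w, w ∈ cl z ↔
      (w ∉ A ∧ ¬ G.Adj w a ∧ ¬ G.Adj w b) ∧ (w = z ∨ G.Adj w z) := by
    intro z w; simp [cl]
  have tr : ∀ x y z, (x ∉ A ∧ ¬ G.Adj x a ∧ ¬ G.Adj x b) → (y ∉ A ∧ ¬ G.Adj y a ∧ ¬ G.Adj y b) →
      (z ∉ A ∧ ¬ G.Adj z a ∧ ¬ G.Adj z b) → (x = y ∨ G.Adj x y) → (y = z ∨ G.Adj y z) →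
      (x = z ∨ G.Adj x z) := by
    intro x y z hx hy hz hxy hyz
    rcases hxy with rfl | hxy
    · exact hyz
    rcases hyz with rfl | hyz
    · exact Or.inr hxy
    by_cases hxz : x = z
    · exact Or.inl hxz
    · exact Or.inr (h.trans h.ha h.hb h.hab hx.2 hy.2 hz.2 hxy hyz hxz)
  have sy : ∀ x y, (x = y ∨ G.Adj x y) → (y = x ∨ G.Adj y x) := by
    intro x y hxy
    rcases hxy with rfl | hxy
    · exact Or.inl rfl
    · exact Or.inr hxy.symm
  have ex : ∀ z, ∃ g : V → V, (z ∉ A ∧ ¬ G.Adj z a ∧ ¬ G.Adj z b) →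
      (∀ w ∈ cl z, g w ∈ A ∧ ¬ G.Adj w (g w)) ∧
        ∀ y ∈ cl z, ∀ w ∈ cl z, g y = g w → y = w := by
    intro z
    by_cases hz : z ∉ A ∧ ¬ G.Adj z a ∧ ¬ G.Adj z b
    · obtain ⟨g, hg⟩ := h.hall (cl z) (by
        intro x hx y hy hxy
        rw [mcl] at hx hy
        exact (tr x z y hx.1 hz hy.1 hx.2 (sy _ _ hy.2)).resolve_left hxy)
        (fun w hw => ((mcl _ _).1 hw).1.1)
      exact ⟨g, fun _ => hg⟩
    · exact ⟨id, fun q => absurd q hz⟩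
  have ex2 : ∀ Q : Finset V, ∃ g : V → V, ∀ z, (z ∉ A ∧ ¬ G.Adj z a ∧ ¬ G.Adj z b) → cl z = Q →
      (∀ w ∈ Q, g w ∈ A ∧ ¬ G.Adj w (g w)) ∧ ∀ y ∈ Q, ∀ w ∈ Q, g y = g w → y = w := by
    intro Q
    by_cases hQ : ∃ z, (z ∉ A ∧ ¬ G.Adj z a ∧ ¬ G.Adj z b) ∧ cl z = Q
    · obtain ⟨z, hz, rfl⟩ := hQ
      obtain ⟨g, hg⟩ := ex z
      exact ⟨g, fun _ _ _ => hg hz⟩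
    · exact ⟨id, fun z h1 h2 => absurd ⟨z, h1, h2⟩ hQ⟩
  choose g hg using ex2
  refine ⟨fun z => g (cl z) z, ?_, ?_⟩
  · intro z h1 h2 h3
    exact (hg (cl z) z ⟨h1, h2, h3⟩ rfl).1 z ((mcl _ _).2 ⟨⟨h1, h2, h3⟩, Or.inl rfl⟩)
  · intro y z y1 y2 y3 z1 z2 z3 hyz heq
    have hy : y ∉ A ∧ ¬ G.Adj y a ∧ ¬ G.Adj y b := ⟨y1, y2, y3⟩
    have hz : z ∉ A ∧ ¬ G.Adj z a ∧ ¬ G.Adj z b := ⟨z1, z2, z3⟩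
    have hcl : cl y = cl z := by
      ext w
      rw [mcl, mcl]
      exact ⟨fun q => ⟨q.1, tr w y z q.1 hy hz q.2 (Or.inr hyz)⟩,
        fun q => ⟨q.1, tr w z y q.1 hz hy q.2 (Or.inr hyz.symm)⟩⟩
    have heq' : g (cl y) y = g (cl z) z := heq
    rw [hcl] at heq'
    refine G.ne_of_adj hyz ((hg (cl z) z hz rfl).2 y ?_ z ?_ heq')
    · exact (mcl _ _).2 ⟨hy, Or.inr hyz⟩
    · exact (mcl _ _).2 ⟨hz, Or.inl rfl⟩

theorem KCtx.colorable [Fintype V] (h : KCtx G A K a b) : G.Colorable (2 * A.card) := by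
  classical
  obtain ⟨g, hg1, hg2⟩ := h.colC
  obtain ⟨f1, f1p, f1w⟩ := h.height h.ha
    (fun x => x ∉ A ∧ G.Adj x a ∧ (nb G A x).card + 2 ≤ A.card)
    (fun x q => q.1) (fun x q => q.2.1) (fun x q => q.2.2)
  obtain ⟨f2, f2p, f2w⟩ := h.height h.hb
    (fun x => x ∉ A ∧ (¬ G.Adj x a ∧ G.Adj x b) ∧ (nb G A x).card + 2 ≤ A.card)
    (fun x q => q.1) (fun x q => q.2.1.2) (fun x q => q.2.2)
  have cross : ∀ x y, (x ∉ A ∧ G.Adj x a ∧ (nb G A x).card + 2 ≤ A.card) →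
      (y ∉ A ∧ (¬ G.Adj y a ∧ G.Adj y b) ∧ (nb G A y).card + 2 ≤ A.card) → G.Adj x y →
      f1 x + f2 y + 1 ≤ A.card := by
    intro x y hx hy hxy
    obtain ⟨_, _, P, hxP, hPc, hP, hP'⟩ := f1w x hx
    obtain ⟨_, _, U, hyU, hUc, hU, hU'⟩ := f2w y hy
    rw [← hPc, ← hUc]
    exact h.main hP (fun z hz => (hP' z hz).1.1) (fun z hz => (hP' z hz).2)
      (fun z hz => (hP' z hz).1.2.1) hU (fun z hz => (hU' z hz).1.1) (fun z hz => (hU' z hz).2)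
      (fun z hz => (hU' z hz).1.2.1.2) (fun z hz => (hU' z hz).1.2.1.1) hxP hyU hx.2.2 hy.2.2 hxy
  have h5 := h.five
  have split : ∀ v, v ∈ A ∨ (v ∉ A ∧ ¬ G.Adj v a ∧ ¬ G.Adj v b) ∨
      (v ∉ A ∧ (G.Adj v a ∨ G.Adj v b) ∧ ¬ (nb G A v).card + 2 ≤ A.card) ∨
      (v ∉ A ∧ G.Adj v a ∧ (nb G A v).card + 2 ≤ A.card) ∨
      (v ∉ A ∧ (¬ G.Adj v a ∧ G.Adj v b) ∧ (nb G A v).card + 2 ≤ A.card) := by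
    intro v; tauto
  let col : V → V ⊕ ℕ := fun v =>
    if v ∈ A then Sum.inl v
    else if ¬ G.Adj v a ∧ ¬ G.Adj v b then Sum.inl (g v)
    else if ¬ (nb G A v).card + 2 ≤ A.card then Sum.inr 0
    else if G.Adj v a then Sum.inr (f1 v)
    else Sum.inr (A.card - f2 v)
  have c1 : ∀ v, v ∈ A → col v = Sum.inl v := by
    intro v hv; simp only [col, if_pos hv]
  have c2 : ∀ v, (v ∉ A ∧ ¬ G.Adj v a ∧ ¬ G.Adj v b) → col v = Sum.inl (g v) := by
    intro v hv; simp only [col, if_neg hv.1, if_pos hv.2]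
  have c3 : ∀ v, (v ∉ A ∧ (G.Adj v a ∨ G.Adj v b) ∧ ¬ (nb G A v).card + 2 ≤ A.card) →
      col v = Sum.inr 0 := by
    intro v hv
    have : ¬ (¬ G.Adj v a ∧ ¬ G.Adj v b) := by tauto
    simp only [col, if_neg hv.1, if_neg this, if_pos hv.2.2]
  have c4 : ∀ v, (v ∉ A ∧ G.Adj v a ∧ (nb G A v).card + 2 ≤ A.card) →
      col v = Sum.inr (f1 v) := by
    intro v hv
    have h1 : ¬ (¬ G.Adj v a ∧ ¬ G.Adj v b) := by tauto
    simp only [col, if_neg hv.1, if_neg h1, if_neg (not_not.2 hv.2.2), if_pos hv.2.1]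
  have c5 : ∀ v, (v ∉ A ∧ (¬ G.Adj v a ∧ G.Adj v b) ∧ (nb G A v).card + 2 ≤ A.card) →
      col v = Sum.inr (A.card - f2 v) := by
    intro v hv
    have h1 : ¬ (¬ G.Adj v a ∧ ¬ G.Adj v b) := by tauto
    simp only [col, if_neg hv.1, if_neg h1, if_neg (not_not.2 hv.2.2), if_neg hv.2.1.1]
  have hmem : ∀ v, col v ∈ A.disjSum (Finset.range A.card) := by
    intro v
    rcases split v with hv | hv | hv | hv | hv
    · rw [c1 v hv]; exact Finset.inl_mem_disjSum.2 hv
    · rw [c2 v hv]; exact Finset.inl_mem_disjSum.2 (hg1 v hv.1 hv.2.1 hv.2.2).1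
    · rw [c3 v hv]; exact Finset.inr_mem_disjSum.2 (Finset.mem_range.2 (by omega))
    · rw [c4 v hv]
      obtain ⟨q1, q2, _⟩ := f1w v hv
      exact Finset.inr_mem_disjSum.2 (Finset.mem_range.2 (by omega))
    · rw [c5 v hv]
      obtain ⟨q1, q2, _⟩ := f2w v hv
      exact Finset.inr_mem_disjSum.2 (Finset.mem_range.2 (by omega))
  have proper : ∀ v w, G.Adj v w → col v ≠ col w := by
    intro v w hvw heq
    rcases split v with hv | hv | hv | hv | hv
    · rw [c1 v hv] at heq
      rcases split w with hw | hw | hw | hw | hw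
      · rw [c1 w hw, Sum.inl.injEq] at heq
        exact G.ne_of_adj hvw heq
      · rw [c2 w hw, Sum.inl.injEq] at heq
        apply (hg1 w hw.1 hw.2.1 hw.2.2).2
        rw [← heq]
        exact hvw.symm
      · rw [c3 w hw] at heq; exact Sum.inl_ne_inr heq
      · rw [c4 w hw] at heq; exact Sum.inl_ne_inr heq
      · rw [c5 w hw] at heq; exact Sum.inl_ne_inr heq
    · rw [c2 v hv] at heq
      rcases split w with hw | hw | hw | hw | hw
      · rw [c1 w hw, Sum.inl.injEq] at heq
        apply (hg1 v hv.1 hv.2.1 hv.2.2).2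
        rw [heq]
        exact hvw
      · rw [c2 w hw, Sum.inl.injEq] at heq
        exact hg2 v w hv.1 hv.2.1 hv.2.2 hw.1 hw.2.1 hw.2.2 hvw heq
      · rw [c3 w hw] at heq; exact Sum.inl_ne_inr heq
      · rw [c4 w hw] at heq; exact Sum.inl_ne_inr heq
      · rw [c5 w hw] at heq; exact Sum.inl_ne_inr heq
    · rw [c3 v hv] at heq
      rcases split w with hw | hw | hw | hw | hw
      · rw [c1 w hw] at heq; exact Sum.inr_ne_inl heq
      · rw [c2 w hw] at heq; exact Sum.inr_ne_inl heq
      · exact h.indep hv.1 hw.1 hv.2.2 hw.2.2 hvw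
      · rw [c4 w hw, Sum.inr.injEq] at heq
        obtain ⟨q1, q2, _⟩ := f1w w hw
        omega
      · rw [c5 w hw, Sum.inr.injEq] at heq
        obtain ⟨q1, q2, _⟩ := f2w w hw
        omega
    · rw [c4 v hv] at heq
      obtain ⟨p1, p2, _⟩ := f1w v hv
      rcases split w with hw | hw | hw | hw | hw
      · rw [c1 w hw] at heq; exact Sum.inr_ne_inl heq
      · rw [c2 w hw] at heq; exact Sum.inr_ne_inl heq
      · rw [c3 w hw, Sum.inr.injEq] at heq
        omega
      · rw [c4 w hw, Sum.inr.injEq] at heq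
        exact f1p v w hv hw hvw heq
      · rw [c5 w hw, Sum.inr.injEq] at heq
        have := cross v w hv hw hvw
        omega
    · rw [c5 v hv] at heq
      obtain ⟨p1, p2, _⟩ := f2w v hv
      rcases split w with hw | hw | hw | hw | hw
      · rw [c1 w hw] at heq; exact Sum.inr_ne_inl heq
      · rw [c2 w hw] at heq; exact Sum.inr_ne_inl heq
      · rw [c3 w hw, Sum.inr.injEq] at heq
        omega
      · rw [c4 w hw, Sum.inr.injEq] at heq
        have := cross w v hw hv hvw.symm
        omega
      · rw [c5 w hw, Sum.inr.injEq] at heq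
        obtain ⟨q1, q2, _⟩ := f2w w hw
        exact f2p v w hv hw hvw (by omega)
  let C : G.Coloring {c // c ∈ A.disjSum (Finset.range A.card)} :=
    Coloring.mk (fun v => ⟨col v, hmem v⟩)
      (fun {v w} hvw heq => proper v w hvw (congrArg Subtype.val heq))
  have := C.colorable
  rwa [Fintype.card_coe, Finset.card_disjSum, Finset.card_range, ← two_mul] at this

theorem exists_KCtx [Fintype V] (h : Ctx G A) : ∃ K a b, KCtx G A K a b := by
  classical
  let F : Finset (Finset V) := Finset.univ.filter (fun Q =>
    (∀ x ∈ Q, ∀ y ∈ Q, x ≠ y → G.Adj x y) ∧ (∀ z ∈ Q, z ∉ A) ∧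
      ∃ i ∈ A, ∃ j ∈ A, i ≠ j ∧ ∀ z ∈ Q, ¬ G.Adj z i ∧ ¬ G.Adj z j)
  have memF : ∀ Q, Q ∈ F ↔ (∀ x ∈ Q, ∀ y ∈ Q, x ≠ y → G.Adj x y) ∧ (∀ z ∈ Q, z ∉ A) ∧
      ∃ i ∈ A, ∃ j ∈ A, i ≠ j ∧ ∀ z ∈ Q, ¬ G.Adj z i ∧ ¬ G.Adj z j := by
    intro Q; simp only [F, Finset.mem_filter, Finset.mem_univ, true_and]
  have hne : F.Nonempty := by
    have h5 := h.five
    obtain ⟨i, hi, j, hj, hij⟩ := Finset.one_lt_card.1 (show 1 < A.card by omega)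
    exact ⟨∅, (memF _).2 ⟨by simp, by simp, i, hi, j, hj, hij, by simp⟩⟩
  obtain ⟨K, hK, hmax⟩ := Finset.exists_max_image F Finset.card hne
  obtain ⟨k1, k2, a, ha, b, hb, hab, k3⟩ := (memF _).1 hK
  have q4 : ∀ z ∈ K, ¬ G.Adj z a := fun z hz => (k3 z hz).1
  have q5 : ∀ z ∈ K, ¬ G.Adj z b := fun z hz => (k3 z hz).2
  refine ⟨K, a, b, KCtx.mk h ha hb hab k1 k2 q4 q5 ?_⟩
  intro Q q1 q2 i hi j hj hij q3
  exact hmax Q ((memF _).2 ⟨q1, q2, i, hi, j, hj, hij, q3⟩)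

theorem p3_of (hP : IsEmpty (P3P2 ↪g G)) : ∀ x y z u v, G.Adj x y → G.Adj y z → x ≠ z →
    ¬ G.Adj x z → G.Adj u v → ¬ G.Adj x u → ¬ G.Adj x v → ¬ G.Adj y u → ¬ G.Adj y v →
    ¬ G.Adj z u → ¬ G.Adj z v → False := by
  intro x y z u v hxy hyz nxz hxz huv hxu hxv hyu hyv hzu hzv
  have a1 := hxy.symm
  have a2 := hyz.symm
  have a3 := huv.symm
  have b1 : ¬ G.Adj z x := fun q => hxz q.symm
  have b2 : ¬ G.Adj u x := fun q => hxu q.symm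
  have b3 : ¬ G.Adj v x := fun q => hxv q.symm
  have b4 : ¬ G.Adj u y := fun q => hyu q.symm
  have b5 : ¬ G.Adj v y := fun q => hyv q.symm
  have b6 : ¬ G.Adj u z := fun q => hzu q.symm
  have b7 : ¬ G.Adj v z := fun q => hzv q.symm
  have n1 := G.ne_of_adj hxy
  have n2 := G.ne_of_adj hyz
  have n3 := G.ne_of_adj huv
  have n4 : x ≠ u := by rintro rfl; exact hyu a1
  have n5 : x ≠ v := by rintro rfl; exact hyv a1
  have n6 : y ≠ u := by rintro rfl; exact hxu hxy
  have n7 : y ≠ v := by rintro rfl; exact hxv hxy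
  have n8 : z ≠ u := by rintro rfl; exact hyu hyz
  have n9 : z ≠ v := by rintro rfl; exact hyv hyz
  refine hP.false ⟨⟨![x, y, z, u, v], ?_⟩, ?_⟩
  · intro i j hij
    fin_cases i <;> fin_cases j <;> simp_all
  · intro i j
    change G.Adj (![x, y, z, u, v] i) (![x, y, z, u, v] j) ↔ P3P2.Adj i j
    clear hP
    fin_cases i <;> fin_cases j <;>
      simp [P3P2, hxy, hyz, hxz, huv, hxu, hxv, hyu, hyv, hzu, hzv, a1, a2, a3, b1, b2, b3, b4,
        b5, b6, b7]

theorem w4_of (hW : IsEmpty (W4 ↪g G)) : ∀ p q r s h, G.Adj p q → G.Adj q r → G.Adj r s →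
    G.Adj s p → p ≠ r → ¬ G.Adj p r → q ≠ s → ¬ G.Adj q s → G.Adj h p → G.Adj h q →
    G.Adj h r → G.Adj h s → False := by
  intro p q r s h hpq hqr hrs hsp npr hpr nqs hqs hp hq hr hs
  have a1 := hpq.symm
  have a2 := hqr.symm
  have a3 := hrs.symm
  have a4 := hsp.symm
  have a5 := hp.symm
  have a6 := hq.symm
  have a7 := hr.symm
  have a8 := hs.symm
  have b1 : ¬ G.Adj r p := fun q => hpr q.symm
  have b2 : ¬ G.Adj s q := fun q => hqs q.symm
  have n1 := G.ne_of_adj hpq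
  have n2 := G.ne_of_adj hqr
  have n3 := G.ne_of_adj hrs
  have n4 := G.ne_of_adj hsp
  have n5 := G.ne_of_adj hp
  have n6 := G.ne_of_adj hq
  have n7 := G.ne_of_adj hr
  have n8 := G.ne_of_adj hs
  refine hW.false ⟨⟨![p, q, r, s, h], ?_⟩, ?_⟩
  · intro i j hij
    fin_cases i <;> fin_cases j <;> simp_all
  · intro i j
    change G.Adj (![p, q, r, s, h] i) (![p, q, r, s, h] j) ↔ W4.Adj i j
    clear hW
    fin_cases i <;> fin_cases j <;>
      simp [W4, hpq, hqr, hrs, hsp, hpr, hqs, hp, hq, hr, hs, a1, a2, a3, a4, a5, a6, a7, a8,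
        b1, b2]

end Aux

theorem stmt1 {V : Type*} [Fintype V] (G : SimpleGraph V)
    (hP : IsEmpty (P3P2 ↪g G)) (hW : IsEmpty (W4 ↪g G)) (hω : 5 ≤ G.cliqueNum) :
    G.chromaticNumber ≤ (2 * G.cliqueNum : ℕ∞) := by
  obtain ⟨A, hA⟩ := G.exists_isNClique_cliqueNum
  have hc := hA.card_eq
  have ctx : Aux.Ctx G A :=
    { clq := fun x hx y hy hxy => hA.isClique hx hy hxy
      max := fun Q hQ => by
        rw [hc]
        exact IsClique.card_le_cliqueNum (tc := fun x hx y hy hxy => hQ x hx y hy hxy)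
      five := by omega
      p3 := Aux.p3_of hP
      w4 := Aux.w4_of hW }
  obtain ⟨K, a, b, hK⟩ := Aux.exists_KCtx ctx
  have := hK.colorable.chromaticNumber_le
  rw [hc] at this
  exact_mod_cast this
end
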